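/- arXiv:0804.2420 — 2 statements merged into one kernel-verified Lean document; each statement's English description precedes it below -/
import Mathlib

section
/- Let f = (f_1,…,f_n) be polynomials in R[x] with each deg f_i ≥ 1, δ_f = Σ_{i=1}^n (deg f_i − 1), and let δ ≥ 0 be an integer. Let L be an R-linear functional on R[x] that annuls (f)^{≤δ_f+δ}_x, and let F ∈ R[x] with deg F ≤ d. Fix monotonous difference derivatives ∇f_i of the f_i, and let ∇'F and ∇''F be two difference derivatives of F all of whose components have total degree ≤ d − 1. Then the polynomials H'(x) = L(y_*).det‖∇f ∇'F; f(x) F(x)‖ and H''(x) = L(y_*).det‖∇f ∇''F; f(x) F(x)‖ satisfy H'(x) − H''(x) ∈ (f)^{≤d−δ−1}_x. -/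
open MvPolynomial Finset

noncomputable section

variable {R : Type*} [CommRing R] {n : ℕ}

/-- Total degree of a multivariate polynomial, valued in `WithBot ℤ`,
with the convention `deg 0 = ⊥` (i.e. `-∞`). -/
def mdeg {σ S : Type*} [CommSemiring S] (F : MvPolynomial σ S) : WithBot ℤ :=
  F.support.sup fun m => ((m.sum fun _ e => e : ℕ) : ℤ)

/-- The embedding `R[x] → R[x,y]`, `x_i ↦ x_i` (the x-variables are `Sum.inl`,
the y-variables are `Sum.inr`). -/
def toX : MvPolynomial (Fin n) R →ₐ[R] MvPolynomial (Fin n ⊕ Fin n) R :=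
  rename Sum.inl

/-- The embedding `R[x] → R[x,y]`, `x_i ↦ y_i`. -/
def toY : MvPolynomial (Fin n) R →ₐ[R] MvPolynomial (Fin n ⊕ Fin n) R :=
  rename Sum.inr

/-- `D = (∇¹F, …, ∇ⁿF)` is a difference derivative of `F`:
`∑ k, (x_k - y_k) * ∇ᵏF(x,y) = F(x) - F(y)`. -/
def IsDiffDeriv (F : MvPolynomial (Fin n) R)
    (D : Fin n → MvPolynomial (Fin n ⊕ Fin n) R) : Prop :=
  ∑ k : Fin n, (X (Sum.inl k) - X (Sum.inr k)) * D k = toX F - toY F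

/-- A difference derivative of `F` is monotonous if each component has total degree
`≤ deg F - 1` (equivalently `deg (∇ᵏF) + 1 ≤ deg F` in `WithBot ℤ`). -/
def IsMonotonous (F : MvPolynomial (Fin n) R)
    (D : Fin n → MvPolynomial (Fin n ⊕ Fin n) R) : Prop :=
  ∀ k, mdeg (D k) + 1 ≤ mdeg F

/-- `δ_f = ∑ᵢ (deg fᵢ - 1)`. -/
def deltaF (f : Fin n → MvPolynomial (Fin n) R) : ℤ :=
  ∑ i, (((f i).totalDegree : ℤ) - 1)

/-- `(f)^{≤ d}_x`: sums `∑ fᵢ gᵢ` with `deg fᵢ + deg gᵢ ≤ d` for every `i`. -/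
def boundedSpan (f : Fin n → MvPolynomial (Fin n) R) (d : WithBot ℤ) :
    Set (MvPolynomial (Fin n) R) :=
  {F | ∃ g : Fin n → MvPolynomial (Fin n) R,
    F = ∑ i, f i * g i ∧ ∀ i, mdeg (f i) + mdeg (g i) ≤ d}

/-- A linear functional `L` annuls a set `S` if it vanishes on it. -/
def Annuls (L : MvPolynomial (Fin n) R →ₗ[R] R) (S : Set (MvPolynomial (Fin n) R)) : Prop :=
  ∀ F ∈ S, L F = 0

/-- `L(y_*).P` : apply the functional `L` to the `y`-part of `P ∈ R[x,y]`,
i.e. if `P = ∑_α A_α(x) y^α` then `L(y_*).P = ∑_α L(y^α) • A_α(x)`. -/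
def applyY (L : MvPolynomial (Fin n) R →ₗ[R] R) (P : MvPolynomial (Fin n ⊕ Fin n) R) :
    MvPolynomial (Fin n) R :=
  ∑ m ∈ P.support,
    C (L (monomial (Finsupp.sumFinsuppAddEquivProdFinsupp m).2 (1 : R)) * P.coeff m) *
      monomial (Finsupp.sumFinsuppAddEquivProdFinsupp m).1 (1 : R)

/-- `det‖∇f(x,y) ∇F(x,y); f(x) F(x)‖` : the `(n+1) × (n+1)` determinant whose entry `(k,i)`
is `∇ᵏfᵢ(x,y)` for `k, i ≤ n`, entry `(k, n+1)` is `∇ᵏF(x,y)`, entry `(n+1, i)` is `fᵢ(x)`,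
and entry `(n+1, n+1)` is `F(x)`.  Here `Df i` is the tuple `(∇¹fᵢ, …, ∇ⁿfᵢ)`. -/
def ddetX (f : Fin n → MvPolynomial (Fin n) R)
    (Df : Fin n → Fin n → MvPolynomial (Fin n ⊕ Fin n) R)
    (F : MvPolynomial (Fin n) R) (DF : Fin n → MvPolynomial (Fin n ⊕ Fin n) R) :
    MvPolynomial (Fin n ⊕ Fin n) R :=
  Matrix.det (Matrix.of fun k i : Fin (n + 1) =>
    if hk : (k : ℕ) < n then
      if hi : (i : ℕ) < n then Df ⟨i, hi⟩ ⟨k, hk⟩ else DF ⟨k, hk⟩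
    else
      if hi : (i : ℕ) < n then toX (f ⟨i, hi⟩) else toX F)

/-- `det‖∇f(x,y) ∇F(x,y); f(y) F(y)‖` : as `ddetX` but with last row `(f₁(y),…,fₙ(y),F(y))`. -/
def ddetY (f : Fin n → MvPolynomial (Fin n) R)
    (Df : Fin n → Fin n → MvPolynomial (Fin n ⊕ Fin n) R)
    (F : MvPolynomial (Fin n) R) (DF : Fin n → MvPolynomial (Fin n ⊕ Fin n) R) :
    MvPolynomial (Fin n ⊕ Fin n) R :=
  Matrix.det (Matrix.of fun k i : Fin (n + 1) =>
    if hk : (k : ℕ) < n then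
      if hi : (i : ℕ) < n then Df ⟨i, hi⟩ ⟨k, hk⟩ else DF ⟨k, hk⟩
    else
      if hi : (i : ℕ) < n then toY (f ⟨i, hi⟩) else toY F)

/-- `P` has total degree at most `e`. -/
def DB {σ : Type*} (P : MvPolynomial σ R) (e : ℤ) : Prop :=
  ∀ m, coeff m P ≠ 0 → (m.degree : ℤ) ≤ e

lemma mdeg_le_iff {σ : Type*} (P : MvPolynomial σ R) (e : ℤ) :
    mdeg P ≤ (e : WithBot ℤ) ↔ DB P e := by
  unfold mdeg DB
  rw [Finset.sup_le_iff]
  simp only [mem_support_iff]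
  refine forall_congr' fun m => forall_congr' fun _ => ?_
  rw [WithBot.coe_le_coe]
  rfl

lemma mdeg_eq {σ : Type*} (P : MvPolynomial σ R) (h : P ≠ 0) :
    mdeg P = ((P.totalDegree : ℤ) : WithBot ℤ) := by
  apply le_antisymm
  · rw [mdeg_le_iff]
    intro m hm
    exact_mod_cast le_totalDegree (mem_support_iff.2 hm)
  · obtain ⟨m, hm, h2⟩ := Finset.exists_mem_eq_sup P.support (support_nonempty.2 h)
      (fun m => m.sum fun _ e => e)
    unfold mdeg
    have : P.totalDegree = m.sum fun _ e => e := h2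
    rw [this]
    exact Finset.le_sup (f := fun m : σ →₀ ℕ => (((m.sum fun _ e => e : ℕ) : ℤ) : WithBot ℤ)) hm

namespace DB
variable {σ : Type*} {P Q : MvPolynomial σ R} {a b : ℤ}

lemma zero : DB (0 : MvPolynomial σ R) a := by
  intro m h
  simp at h

lemma mono (h : DB P a) (hab : a ≤ b) : DB P b := fun m hm => (h m hm).trans hab

lemma add (hP : DB P a) (hQ : DB Q a) : DB (P + Q) a := by
  intro m hm
  by_cases h : coeff m P = 0
  · apply hQ
    intro h'
    simp [h, h'] at hm
  · exact hP m h

lemma neg (hP : DB P a) : DB (-P) a := by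
  intro m hm
  apply hP
  simpa using hm

lemma sub (hP : DB P a) (hQ : DB Q a) : DB (P - Q) a := by
  rw [sub_eq_add_neg]
  exact hP.add hQ.neg

lemma sum {ι : Type*} (s : Finset ι) (g : ι → MvPolynomial σ R)
    (h : ∀ i ∈ s, DB (g i) a) : DB (∑ i ∈ s, g i) a := by
  classical
  induction s using Finset.induction_on with
  | empty => simpa using zero
  | insert i s hi ih =>
    rw [Finset.sum_insert hi]
    exact (h i (by simp)).add (ih fun j hj => h j (by simp [hj]))

lemma mul (hP : DB P a) (hQ : DB Q b) : DB (P * Q) (a + b) := by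
  classical
  intro m hm
  rw [coeff_mul] at hm
  obtain ⟨x, hx, h⟩ := Finset.exists_ne_zero_of_sum_ne_zero hm
  have h1 := hP x.1 (left_ne_zero_of_mul h)
  have h2 := hQ x.2 (right_ne_zero_of_mul h)
  rw [HasAntidiagonal.mem_antidiagonal] at hx
  rw [← hx, map_add]
  push_cast
  linarith

lemma C (r : R) : DB (MvPolynomial.C r : MvPolynomial σ R) 0 := by
  classical
  intro m hm
  rw [coeff_C] at hm
  have : 0 = m := by
    by_contra h
    simp [h] at hm
  simp [← this]

lemma one : DB (1 : MvPolynomial σ R) 0 := by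
  simpa using DB.C (σ := σ) (1 : R)

lemma X (i : σ) : DB (MvPolynomial.X i : MvPolynomial σ R) 1 := by
  classical
  intro m hm
  rw [coeff_X] at hm
  have : Finsupp.single i 1 = m := by
    by_contra h
    simp [h] at hm
  simp [← this]

lemma prod {ι : Type*} (s : Finset ι) (g : ι → MvPolynomial σ R) (c : ι → ℤ)
    (h : ∀ i ∈ s, DB (g i) (c i)) : DB (∏ i ∈ s, g i) (∑ i ∈ s, c i) := by
  classical
  induction s using Finset.induction_on with
  | empty => simpa using one
  | insert i s hi ih =>
    rw [Finset.sum_insert hi, Finset.prod_insert hi]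
    exact (h i (by simp)).mul (ih fun j hj => h j (by simp [hj]))

lemma pow (h : DB P a) (k : ℕ) : DB (P ^ k) (k * a) := by
  have := prod (Finset.range k) (fun _ => P) (fun _ => a) (fun _ _ => h)
  simpa using this

lemma aeval {τ : Type*} [Fintype σ] (g : σ → MvPolynomial τ R) (hg : ∀ i, DB (g i) 1)
    (h : DB P a) : DB (MvPolynomial.aeval g P) a := by
  rw [aeval_def, eval₂_eq']
  apply sum
  intro m hm
  have h1 := prod Finset.univ (fun i => g i ^ m i) (fun i => (m i : ℤ) * 1)
    (fun i _ => (hg i).pow _)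
  have h2 := (DB.C (σ := τ) (coeff m P)).mul h1
  refine h2.mono ?_
  have h3 := h m (mem_support_iff.1 hm)
  rw [Finsupp.degree_eq_sum] at h3
  push_cast at h3
  simpa using h3

lemma det {ι : Type*} [Fintype ι] [DecidableEq ι] (M : Matrix ι ι (MvPolynomial σ R))
    (c : ι → ℤ) (h : ∀ r i, DB (M r i) (c i)) : DB M.det (∑ i, c i) := by
  rw [Matrix.det_apply]
  apply sum
  intro p _
  have h1 : DB (∏ i, M (p i) i) (∑ i, c i) := prod _ _ _ fun i _ => h _ _
  rcases Int.units_eq_one_or (Equiv.Perm.sign p) with h2 | h2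
  · simpa [h2] using h1
  · simpa [h2] using h1.neg

end DB

/-- Koszul exactness in the variables `X (inl k)`, with degree control. -/
lemma koszul_X {τ : Type*} (G : Fin n → MvPolynomial (Fin n ⊕ τ) R)
    (hG : ∑ k, X (Sum.inl k) * G k = 0) (e : ℤ) (hd : ∀ k, DB (G k) e) :
    ∃ D : Fin n → Fin n → MvPolynomial (Fin n ⊕ τ) R,
      (∀ k, G k = ∑ j, X (Sum.inl j) * (D k j - D j k)) ∧ ∀ k j, DB (D k j) (e - 1) := by
  classical
  have key : ∀ j k : Fin n, ∃ Q : MvPolynomial (Fin n ⊕ τ) R, ∀ s,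
      coeff s Q = if j < k ∧ ∀ i < j, s (Sum.inl i) = 0
        then - coeff (s + Finsupp.single (Sum.inl j) 1) (G k) else 0 := by
    intro j k
    let W := (G k).divMonomial (Finsupp.single (Sum.inl j) 1)
    refine ⟨∑ m ∈ W.support, monomial m
      (if j < k ∧ ∀ i < j, m (Sum.inl i) = 0 then - coeff m W else 0), fun s => ?_⟩
    rw [coeff_sum]
    simp only [coeff_monomial]
    rw [Finset.sum_ite_eq']
    have hW : coeff s W = coeff (s + Finsupp.single (Sum.inl j) 1) (G k) := by
      rw [coeff_divMonomial, add_comm]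
    rw [← hW]
    by_cases hs : s ∈ W.support
    · simp [hs]
    · have : coeff s W = 0 := by simpa using hs
      simp [this]
  choose D hD using key
  refine ⟨D, fun k => ?_, fun k j => ?_⟩
  · ext s
    rw [coeff_sum]
    simp only [coeff_X_mul', coeff_sub, hD]
    by_cases hs : ∀ i < k, s (Sum.inl i) = 0
    · have h1 := congrArg (coeff (s + Finsupp.single (Sum.inl k) 1)) hG
      rw [coeff_sum, coeff_zero, ← Finset.add_sum_erase _ _ (Finset.mem_univ k)] at h1
      rw [← Finset.add_sum_erase _ _ (Finset.mem_univ k)]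
      simp only [coeff_X_mul'] at h1
      simp only [lt_irrefl, false_and, if_false, sub_zero, ite_self, zero_add]
      rw [if_pos (by simp), add_tsub_cancel_right] at h1
      rw [eq_neg_of_add_eq_zero_left h1, ← Finset.sum_neg_distrib]
      refine Finset.sum_congr rfl fun j hj => ?_
      have hjk : j ≠ k := (Finset.mem_erase.1 hj).1
      have hmem : (Sum.inl j ∈ (s + Finsupp.single (Sum.inl k) 1 : Fin n ⊕ τ →₀ ℕ).support) ↔
          Sum.inl j ∈ s.support := by
        simp [Finsupp.single_apply, hjk.symm]
      rw [if_congr hmem rfl rfl]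
      by_cases hj' : Sum.inl j ∈ s.support
      · have hlt : k < j := by
          rcases lt_trichotomy j k with h | h | h
          · simp [hs j h] at hj'
          · exact absurd h hjk
          · exact h
        have hle : Finsupp.single (Sum.inl j) 1 ≤ s := by
          rw [Finsupp.single_le_iff]
          have : s (Sum.inl j) ≠ 0 := by simpa using hj'
          omega
        rw [if_pos hj', if_pos hj', if_pos, if_neg, sub_zero, tsub_add_eq_add_tsub hle]
        · exact fun h => absurd h.1 (not_lt.2 hlt.le)
        · refine ⟨hlt, fun i hi => ?_⟩
          simp [hs i hi]
      · rw [if_neg hj', if_neg hj', neg_zero]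
    · -- the minimal index
      push Not at hs
      obtain ⟨i₀, hi₀, hi₀'⟩ := hs
      have hex : ∃ j, s (Sum.inl j) ≠ 0 ∧ ∀ i < j, s (Sum.inl i) = 0 := by
        have hne : (Finset.univ.filter fun j : Fin n => s (Sum.inl j) ≠ 0).Nonempty :=
          ⟨i₀, by simp [hi₀']⟩
        refine ⟨_, (Finset.mem_filter.1 (Finset.min'_mem _ hne)).2, fun i hi => ?_⟩
        by_contra h
        exact absurd (Finset.min'_le _ i (by simp [h])) (not_le.2 hi)
      obtain ⟨j₀, h1, h2⟩ := hex
      have hj₀ : j₀ < k := by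
        refine lt_of_le_of_lt ?_ hi₀
        by_contra h
        exact hi₀' (h2 _ (not_le.1 h))
      have hle : Finsupp.single (Sum.inl j₀) 1 ≤ s := by
        rw [Finsupp.single_le_iff]
        omega
      rw [Finset.sum_eq_single j₀]
      · rw [if_pos (by simpa using h1), if_neg, if_pos, tsub_add_cancel_of_le hle]
        · simp
        · refine ⟨hj₀, fun i hi => ?_⟩
          simp [h2 i hi]
        · exact fun h => absurd h.1 (not_lt.2 hj₀.le)
      · intro j _ hj
        by_cases hjs : Sum.inl j ∈ s.support
        · have hjj : j₀ < j := by
            rcases lt_trichotomy j j₀ with h | h | h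
            · simp [h2 j h] at hjs
            · exact absurd h hj
            · exact h
          rw [if_pos hjs, if_neg, if_neg, sub_zero]
          · rintro ⟨h3, h4⟩
            have := h4 j₀ hjj
            simp [Finsupp.single_apply, hj] at this
            exact h1 this
          · rintro ⟨h3, h4⟩
            have := h4 j₀ hj₀
            simp [Finsupp.single_apply, hj] at this
            exact h1 this
        · rw [if_neg hjs]
      · simp
  · intro m hm
    rw [hD] at hm
    have hm' : coeff (m + Finsupp.single (Sum.inl k) 1) (G j) ≠ 0 := by
      intro h
      simp [h] at hm
    have := hd j _ hm'
    simp at this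
    linarith

lemma koszul_sub (G : Fin n → MvPolynomial (Fin n ⊕ Fin n) R)
    (hG : ∑ k, (X (Sum.inl k) - X (Sum.inr k)) * G k = 0) (e : ℤ) (hd : ∀ k, DB (G k) e) :
    ∃ D : Fin n → Fin n → MvPolynomial (Fin n ⊕ Fin n) R,
      (∀ k, G k = ∑ j, (X (Sum.inl j) - X (Sum.inr j)) * (D k j - D j k)) ∧
        ∀ k j, DB (D k j) (e - 1) := by
  let gφ : Fin n ⊕ Fin n → MvPolynomial (Fin n ⊕ Fin n) R :=
    Sum.elim (fun k => X (Sum.inl k) + X (Sum.inr k)) (fun k => X (Sum.inr k))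
  let gψ : Fin n ⊕ Fin n → MvPolynomial (Fin n ⊕ Fin n) R :=
    Sum.elim (fun k => X (Sum.inl k) - X (Sum.inr k)) (fun k => X (Sum.inr k))
  have hgφ : ∀ i, DB (gφ i) 1 := by
    rintro (i | i)
    · exact (DB.X _).add (DB.X _)
    · exact DB.X _
  have hgψ : ∀ i, DB (gψ i) 1 := by
    rintro (i | i)
    · exact (DB.X _).sub (DB.X _)
    · exact DB.X _
  have hinv : ∀ P, aeval gψ (aeval gφ P) = P := by
    intro P
    have : (aeval gψ).comp (aeval gφ) = AlgHom.id R (MvPolynomial (Fin n ⊕ Fin n) R) := by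
      apply MvPolynomial.algHom_ext
      rintro (i | i) <;> simp [gφ, gψ]
    exact congrArg (fun F => F P) this
  obtain ⟨D, h1, h2⟩ := koszul_X (fun k => aeval gφ (G k)) (by
    have := congrArg (aeval gφ) hG
    simpa [map_sum, gφ] using this) e (fun k => (hd k).aeval gφ hgφ)
  refine ⟨fun k j => aeval gψ (D k j), fun k => ?_, fun k j => (h2 k j).aeval gψ hgψ⟩
  have := congrArg (aeval gψ) (h1 k)
  rw [hinv] at this
  rw [this]
  simp [map_sum, gψ]

lemma coeff_coeff_sumAlgEquiv (P : MvPolynomial (Fin n ⊕ Fin n) R) (α β : Fin n →₀ ℕ) :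
    coeff β (coeff α (sumAlgEquiv R (Fin n) (Fin n) P)) =
      coeff (Finsupp.sumFinsuppAddEquivProdFinsupp.symm (α, β)) P := by
  classical
  induction P using MvPolynomial.induction_on' with
  | add p q hp hq => rw [map_add, coeff_add, coeff_add, coeff_add, hp, hq]
  | monomial m r =>
    have h : sumAlgEquiv R (Fin n) (Fin n) (monomial m r) =
        monomial (Finsupp.sumFinsuppAddEquivProdFinsupp m).1
          (monomial (Finsupp.sumFinsuppAddEquivProdFinsupp m).2 r) := by
      change AddMonoidAlgebra.curryAlgEquiv R (AddMonoidAlgebra.domCongr R R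
        Finsupp.sumFinsuppAddEquivProdFinsupp (AddMonoidAlgebra.single m r)) = _
      rw [AddMonoidAlgebra.domCongr_single]
      exact AddMonoidAlgebra.curryAlgEquiv_single _ _ _
    rw [h, coeff_monomial, coeff_monomial]
    by_cases h1 : (Finsupp.sumFinsuppAddEquivProdFinsupp m).1 = α
    · rw [if_pos h1, coeff_monomial]
      refine if_congr ?_ rfl rfl
      rw [AddEquiv.eq_symm_apply, Prod.ext_iff]
      simp only [h1, true_and]
    · rw [if_neg h1, coeff_zero, if_neg]
      intro h2
      rw [AddEquiv.eq_symm_apply] at h2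
      exact h1 (congrArg Prod.fst h2)

lemma sumAlgEquiv_toX (p : MvPolynomial (Fin n) R) :
    sumAlgEquiv R (Fin n) (Fin n) (toX p) = map C p := by
  have := congrArg (fun F => F p) (sumAlgEquiv_comp_rename_inl (R := R) (S₁ := Fin n) (S₂ := Fin n))
  exact this

lemma sumAlgEquiv_toY (p : MvPolynomial (Fin n) R) :
    sumAlgEquiv R (Fin n) (Fin n) (toY p) = C p := by
  have := congrArg (fun F => F p) (sumAlgEquiv_comp_rename_inr (R := R) (S₁ := Fin n) (S₂ := Fin n))
  exact this

lemma coeff_applyY (L : MvPolynomial (Fin n) R →ₗ[R] R) (P : MvPolynomial (Fin n ⊕ Fin n) R)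
    (α : Fin n →₀ ℕ) :
    coeff α (applyY L P) = L (coeff α (sumAlgEquiv R (Fin n) (Fin n) P)) := by
  classical
  have h : coeff α (sumAlgEquiv R (Fin n) (Fin n) P) = ∑ m ∈ P.support,
      if (Finsupp.sumFinsuppAddEquivProdFinsupp m).1 = α then
        coeff m P • monomial (Finsupp.sumFinsuppAddEquivProdFinsupp m).2 (1 : R) else 0 := by
    ext β
    rw [coeff_coeff_sumAlgEquiv, coeff_sum]
    rw [Finset.sum_eq_single (Finsupp.sumFinsuppAddEquivProdFinsupp.symm (α, β))]
    · simp
    · intro m _ hm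
      split_ifs with h1
      · rw [coeff_smul, coeff_monomial, if_neg, smul_zero]
        intro h2
        apply hm
        rw [AddEquiv.eq_symm_apply, ← h1, ← h2]
      · simp
    · intro h
      simpa using h
  rw [h, map_sum, applyY, coeff_sum]
  refine Finset.sum_congr rfl fun m _ => ?_
  rw [coeff_C_mul, coeff_monomial]
  split_ifs
  · rw [map_smul, smul_eq_mul]
    ring
  · simp

lemma applyY_sub (L : MvPolynomial (Fin n) R →ₗ[R] R) (P Q : MvPolynomial (Fin n ⊕ Fin n) R) :
    applyY L P - applyY L Q = applyY L (P - Q) := by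
  ext α
  simp [coeff_applyY]

lemma applyY_sum {ι : Type*} (s : Finset ι) (L : MvPolynomial (Fin n) R →ₗ[R] R)
    (P : ι → MvPolynomial (Fin n ⊕ Fin n) R) :
    applyY L (∑ i ∈ s, P i) = ∑ i ∈ s, applyY L (P i) := by
  ext α
  simp [coeff_applyY, coeff_sum]

lemma applyY_toX_mul (L : MvPolynomial (Fin n) R →ₗ[R] R) (p : MvPolynomial (Fin n) R)
    (P : MvPolynomial (Fin n ⊕ Fin n) R) :
    applyY L (toX p * P) = p * applyY L P := by
  classical
  ext α
  rw [coeff_applyY, map_mul, sumAlgEquiv_toX, coeff_mul, coeff_mul, map_sum]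
  refine Finset.sum_congr rfl fun x _ => ?_
  rw [coeff_map, coeff_applyY, ← smul_eq_C_mul, map_smul, smul_eq_mul]

lemma DB.coeff_sum {P : MvPolynomial (Fin n ⊕ Fin n) R} {a : ℤ} (h : DB P a)
    (α : Fin n →₀ ℕ) :
    DB (coeff α (sumAlgEquiv R (Fin n) (Fin n) P)) (a - α.degree) := by
  intro β hβ
  rw [coeff_coeff_sumAlgEquiv] at hβ
  have := h _ hβ
  rw [Finsupp.degree_eq_sum, Fintype.sum_sum_type] at this
  simp only [Finsupp.sumFinsuppAddEquivProdFinsupp_symm_inl,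
    Finsupp.sumFinsuppAddEquivProdFinsupp_symm_inr] at this
  rw [Finsupp.degree_eq_sum, Finsupp.degree_eq_sum]
  push_cast at this ⊢
  linarith

section det
variable {S : Type*} [CommRing S]

/-- the matrix `M` with column `i` replaced by `e_k` and column `l` by `e_j`, determinant -/
def EE (M : Matrix (Fin n) (Fin n) S) (i l k j : Fin n) : S :=
  ((M.updateCol i (Pi.single k 1)).updateCol l (Pi.single j 1)).det

lemma EE_swap (M : Matrix (Fin n) (Fin n) S) (i l k j : Fin n) (h : i ≠ l) :
    EE M l i k j = - EE M i l k j := by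
  unfold EE
  have := Matrix.det_permute' (Equiv.swap i l)
    ((M.updateCol i (Pi.single k 1)).updateCol l (Pi.single j 1))
  rw [Equiv.Perm.sign_swap h] at this
  simp only [Units.val_neg, Units.val_one, Int.cast_neg, Int.cast_one, neg_mul, one_mul] at this
  rw [← this]
  congr 1
  ext r c
  by_cases hi : c = i
  · subst hi
    simp [Matrix.updateCol_apply]
  · by_cases hl : c = l
    · subst hl
      simp [Matrix.updateCol_apply, h, hi]
    · simp [Matrix.updateCol_apply, hi, hl, Equiv.swap_apply_of_ne_of_ne hi hl]

lemma sum_EE (M : Matrix (Fin n) (Fin n) S) (u : Fin n → S) (i k j : Fin n) :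
    ∑ l ∈ univ.erase i, (∑ r, u r * M r l) * EE M i l k j =
      u j * (M.updateCol i (Pi.single k 1)).det - u k * (M.updateCol i (Pi.single j 1)).det := by
  set N := M.updateCol i (Pi.single k 1) with hN
  have h := congrArg (fun v => ∑ r, u r * v r) (Matrix.mulVec_cramer N (Pi.single j 1))
  simp only [Matrix.mulVec, dotProduct, Matrix.cramer_apply, Pi.smul_apply, smul_eq_mul,
    Pi.single_apply, mul_ite, mul_one, mul_zero, Finset.sum_ite_eq', Finset.mem_univ,
    if_true, Finset.mul_sum] at h
  rw [Finset.sum_comm, ← Finset.add_sum_erase _ _ (Finset.mem_univ i)] at h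
  have h1 : ∑ r, u r * (N r i * (N.updateCol i (Pi.single j 1)).det) =
      u k * (M.updateCol i (Pi.single j 1)).det := by
    rw [hN]
    simp [Pi.single_apply]
  rw [h1] at h
  rw [← h, add_sub_cancel_left]
  refine Finset.sum_congr rfl fun l hl => ?_
  have hl' : l ≠ i := (Finset.mem_erase.1 hl).1
  rw [Finset.sum_mul]
  refine Finset.sum_congr rfl fun r _ => ?_
  unfold EE
  rw [hN, Matrix.updateCol_ne hl', mul_assoc]

/-- alternating matrix of coefficients -/
def BB (M : Matrix (Fin n) (Fin n) S) (D : Fin n → Fin n → S) (i l : Fin n) : S :=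
  if i = l then 0 else ∑ k, ∑ j, D k j * EE M i l k j

lemma BB_swap (M : Matrix (Fin n) (Fin n) S) (D : Fin n → Fin n → S) (i l : Fin n) :
    BB M D l i = - BB M D i l := by
  unfold BB
  by_cases h : i = l
  · simp [h]
  · rw [if_neg h, if_neg (Ne.symm h)]
    simp only [EE_swap M i l _ _ h, mul_neg, Finset.sum_neg_distrib]

lemma det_updateCol_eq (M : Matrix (Fin n) (Fin n) S) (D : Fin n → Fin n → S) (u G : Fin n → S)
    (hG : ∀ k, G k = ∑ j, u j * (D k j - D j k)) (i : Fin n) :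
    (M.updateCol i G).det = ∑ l, (∑ r, u r * M r l) * BB M D i l := by
  have h0 : (M.updateCol i G).det = ∑ k, G k * (M.updateCol i (Pi.single k 1)).det := by
    rw [← Matrix.cramer_apply]
    have : G = ∑ k, G k • (Pi.single k 1 : Fin n → S) := by
      ext r
      simp [Finset.sum_apply, Pi.single_apply]
    conv_lhs => rw [this]
    rw [map_sum, Finset.sum_apply]
    refine Finset.sum_congr rfl fun k _ => ?_
    rw [map_smul, Pi.smul_apply, Matrix.cramer_apply, smul_eq_mul]
  set c : Fin n → S := fun k => (M.updateCol i (Pi.single k 1)).det with hc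
  have h1 : ∑ k, G k * c k = ∑ k, ∑ j, D k j * (u j * c k - u k * c j) := by
    have e1 : ∑ k, G k * c k = ∑ k, ∑ j, D k j * (u j * c k) - ∑ k, ∑ j, D j k * (u j * c k) := by
      rw [← Finset.sum_sub_distrib]
      refine Finset.sum_congr rfl fun k _ => ?_
      rw [hG, Finset.sum_mul, ← Finset.sum_sub_distrib]
      refine Finset.sum_congr rfl fun j _ => ?_
      ring
    rw [e1, Finset.sum_comm (f := fun k j => D j k * (u j * c k)), ← Finset.sum_sub_distrib]
    refine Finset.sum_congr rfl fun k _ => ?_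
    rw [← Finset.sum_sub_distrib]
    refine Finset.sum_congr rfl fun j _ => ?_
    ring
  rw [h0, h1, ← Finset.add_sum_erase univ (fun l => (∑ r, u r * M r l) * BB M D i l)
    (Finset.mem_univ i)]
  have h2 : BB M D i i = 0 := by simp [BB]
  rw [h2, mul_zero, zero_add]
  have h3 : ∑ l ∈ univ.erase i, (∑ r, u r * M r l) * BB M D i l =
      ∑ l ∈ univ.erase i, ∑ k, ∑ j, D k j * ((∑ r, u r * M r l) * EE M i l k j) := by
    refine Finset.sum_congr rfl fun l hl => ?_
    have hl' : i ≠ l := (Finset.mem_erase.1 hl).1.symm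
    rw [BB, if_neg hl', Finset.mul_sum]
    refine Finset.sum_congr rfl fun k _ => ?_
    rw [Finset.mul_sum]
    refine Finset.sum_congr rfl fun j _ => ?_
    ring
  rw [h3]
  symm
  rw [Finset.sum_comm]
  refine Finset.sum_congr rfl fun k _ => ?_
  rw [Finset.sum_comm]
  refine Finset.sum_congr rfl fun j _ => ?_
  rw [← Finset.mul_sum, sum_EE]

/-- bordered matrix -/
def bord (M : Matrix (Fin n) (Fin n) S) (G r : Fin n → S) (c : S) :
    Matrix (Fin n ⊕ Unit) (Fin n ⊕ Unit) S :=
  Matrix.fromBlocks M (Matrix.of fun k _ => G k) (Matrix.of fun _ i => r i) (Matrix.of fun _ _ => c)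

lemma bord_sub (M : Matrix (Fin n) (Fin n) S) (G G' r : Fin n → S) (c : S) :
    (bord M G r c).det - (bord M G' r c).det = (bord M (G - G') r 0).det := by
  have h1 : ∀ (H : Fin n → S) (a : S), bord M H r a =
      (bord M (G - G') r 0).updateCol (Sum.inr ()) (Sum.elim H fun _ => a) := by
    intro H a
    ext (x | x) (y | y) <;> simp [bord]
  have h2 : (bord M (G - G') r 0).det = _ := congrArg Matrix.det (h1 (G - G') 0)
  rw [h2, h1 G c, h1 G' c, sub_eq_iff_eq_add, ← Matrix.det_updateCol_add]
  congr 2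
  ext (x | x) <;> simp

lemma bord_single (M : Matrix (Fin n) (Fin n) S) (G : Fin n → S) (i : Fin n) :
    (bord M G (Pi.single i 1) 0).det = - (M.updateCol i G).det := by
  have h := Matrix.det_permute' (Equiv.swap (Sum.inl i) (Sum.inr ()))
    (bord M G (Pi.single i 1) 0)
  rw [Equiv.Perm.sign_swap (by simp)] at h
  simp only [Units.val_neg, Units.val_one, Int.cast_neg, Int.cast_one, neg_mul, one_mul] at h
  rw [← neg_eq_iff_eq_neg, ← h]
  have h2 : (bord M G (Pi.single i 1) 0).submatrix id (Equiv.swap (Sum.inl i) (Sum.inr ())) =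
      Matrix.fromBlocks (M.updateCol i G) (Matrix.of fun k _ => M k i) 0 1 := by
    ext (x | x) (y | y)
    · by_cases hy : y = i
      · subst hy
        simp [bord]
      · rw [Matrix.submatrix_apply, Equiv.swap_apply_of_ne_of_ne (by simpa using hy) (by simp)]
        simp [bord, hy]
    · simp [bord]
    · by_cases hy : y = i
      · subst hy
        simp [bord]
      · rw [Matrix.submatrix_apply, Equiv.swap_apply_of_ne_of_ne (by simpa using hy) (by simp)]
        simp [bord, hy]
    · simp [bord]
  rw [h2, Matrix.det_fromBlocks_zero₂₁, Matrix.det_one, mul_one]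

lemma bord_row (M : Matrix (Fin n) (Fin n) S) (G r : Fin n → S) :
    (bord M G r 0).det = - ∑ i, r i * (M.updateCol i G).det := by
  have h1 : ∀ (q : Fin n → S), bord M G q 0 =
      (bord M G r 0).updateRow (Sum.inr ()) (Sum.elim q fun _ => 0) := by
    intro q
    ext (x | x) (y | y) <;> simp [bord]
  let φ : (Fin n → S) →ₗ[S] S :=
    { toFun := fun q => (bord M G q 0).det
      map_add' := by
        intro p q
        rw [h1 p, h1 q, h1 (p + q), ← Matrix.det_updateRow_add]
        congr 2
        ext (x | x) <;> simp
      map_smul' := by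
        intro s q
        rw [h1 q, h1 (s • q), RingHom.id_apply, smul_eq_mul, ← Matrix.det_updateRow_smul]
        congr 2
        ext (x | x) <;> simp }
  have : r = ∑ k, r k • (Pi.single k 1 : Fin n → S) := by
    ext r
    simp [Finset.sum_apply, Pi.single_apply]
  change φ r = _
  conv_lhs => rw [this]
  rw [map_sum, ← Finset.sum_neg_distrib]
  refine Finset.sum_congr rfl fun k _ => ?_
  rw [map_smul, smul_eq_mul]
  change r k * (bord M G (Pi.single k 1) 0).det = _
  rw [bord_single]
  ring

lemma bord_final (M : Matrix (Fin n) (Fin n) S) (D : Fin n → Fin n → S) (u G p q : Fin n → S)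
    (hG : ∀ k, G k = ∑ j, u j * (D k j - D j k))
    (hM : ∀ l, ∑ r, u r * M r l = p l - q l) :
    (bord M G p 0).det = ∑ i, p i * ∑ l, q l * BB M D i l := by
  rw [bord_row]
  simp only [det_updateCol_eq M D u G hG, hM]
  have h1 : ∑ i, p i * ∑ l, p l * BB M D i l = 0 := by
    simp only [Finset.mul_sum]
    have hdiag : ∀ i, BB M D i i = 0 := fun i => by simp [BB]
    rw [← Finset.sum_product']
    refine Finset.sum_involution (fun x _ => (x.2, x.1)) ?_ ?_ ?_ ?_
    · rintro ⟨i, l⟩ _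
      simp only
      rw [BB_swap M D i l]
      ring
    · rintro ⟨i, l⟩ _ h3 h4
      simp only [Prod.mk.injEq] at h4
      apply h3
      simp [h4.1, hdiag]
    · simp
    · simp
  simp only [sub_mul, Finset.sum_sub_distrib, mul_sub]
  rw [h1]
  ring

end det

lemma ddetX_eq_bord (f : Fin n → MvPolynomial (Fin n) R)
    (Df : Fin n → Fin n → MvPolynomial (Fin n ⊕ Fin n) R)
    (F : MvPolynomial (Fin n) R) (DF : Fin n → MvPolynomial (Fin n ⊕ Fin n) R) :
    ddetX f Df F DF =
      (bord (Matrix.of fun k i => Df i k) DF (fun i => toX (f i)) (toX F)).det := by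
  unfold ddetX
  let e : Fin n ⊕ Unit ≃ Fin (n + 1) :=
    (Equiv.sumCongr (Equiv.refl _) (Equiv.ofUnique Unit (Fin 1))).trans finSumFinEquiv
  rw [← Matrix.det_submatrix_equiv_self e]
  congr 1
  ext1 x y
  rcases x with x | x <;> rcases y with y | y <;> simp [bord, e]

lemma DB.BB {M : Matrix (Fin n) (Fin n) (MvPolynomial (Fin n ⊕ Fin n) R)}
    {D : Fin n → Fin n → MvPolynomial (Fin n ⊕ Fin n) R} {c : Fin n → ℤ} {a : ℤ}
    (hM : ∀ r i, DB (M r i) (c i)) (hD : ∀ k j, DB (D k j) a) (i l : Fin n) :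
    DB (_root_.BB M D i l) (a + (∑ m, c m - c i - c l)) := by
  unfold _root_.BB
  split_ifs with h
  · exact DB.zero
  refine DB.sum _ _ fun k _ => DB.sum _ _ fun j _ => (hD k j).mul ?_
  have hs : ∀ (k r : Fin n), DB ((Pi.single k 1 : Fin n → MvPolynomial (Fin n ⊕ Fin n) R) r) 0 := by
    intro k r
    by_cases hr : r = k
    · subst hr
      simpa using DB.one
    · simpa [hr] using DB.zero
  have := DB.det ((M.updateCol i (Pi.single k 1)).updateCol l (Pi.single j 1))
    (Function.update (Function.update c i 0) l 0) (by
      intro r m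
      by_cases hl : m = l
      · subst hl
        simpa using hs j r
      · by_cases hi : m = i
        · subst hi
          simpa [hl] using hs k r
        · simpa [hl, hi] using hM r m)
  refine this.mono (le_of_eq ?_)
  have h1 := Finset.sum_update_of_mem (Finset.mem_univ l) (Function.update c i 0) 0
  rw [h1]
  have h2 := Finset.sum_update_of_mem (Finset.mem_univ i) c 0
  have h3 : ∑ x ∈ univ \ {l}, Function.update c i 0 x =
      ∑ x, Function.update c i 0 x - Function.update c i 0 l := by
    rw [← Finset.sum_sdiff (Finset.subset_univ {l})]
    simp
  have h4 : ∑ x ∈ univ \ {i}, c x = ∑ x, c x - c i := by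
    rw [← Finset.sum_sdiff (Finset.subset_univ {i})]
    simp
  rw [h3, h2, h4, Function.update_of_ne (Ne.symm h)]
  ring

/-- Theorem 2.2, first part: `H(x)` is determined up to an addend in
`(f)^{≤ d - δ - 1}_x` independently of the choice of `∇F`. -/
theorem applyY_ddetX_sub_of_DF {R : Type*} [CommRing R] {n : ℕ}
    (f : Fin n → MvPolynomial (Fin n) R) (hf : ∀ i, (1 : WithBot ℤ) ≤ mdeg (f i))
    (δ : ℤ) (hδ : 0 ≤ δ) (L : MvPolynomial (Fin n) R →ₗ[R] R)
    (hL : Annuls L (boundedSpan f ((deltaF f + δ : ℤ) : WithBot ℤ)))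
    (d : ℤ) (F : MvPolynomial (Fin n) R) (hF : mdeg F ≤ (d : WithBot ℤ))
    (Df : Fin n → Fin n → MvPolynomial (Fin n ⊕ Fin n) R)
    (hDf : ∀ i, IsDiffDeriv (f i) (Df i) ∧ IsMonotonous (f i) (Df i))
    (DF' DF'' : Fin n → MvPolynomial (Fin n ⊕ Fin n) R)
    (hDF' : IsDiffDeriv F DF') (hDF'' : IsDiffDeriv F DF'')
    (hdeg' : ∀ k, mdeg (DF' k) ≤ ((d - 1 : ℤ) : WithBot ℤ))
    (hdeg'' : ∀ k, mdeg (DF'' k) ≤ ((d - 1 : ℤ) : WithBot ℤ)) :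
    applyY L (ddetX f Df F DF') - applyY L (ddetX f Df F DF'') ∈
      boundedSpan f ((d - δ - 1 : ℤ) : WithBot ℤ) := by
  have hne : ∀ i, f i ≠ 0 := by
    intro i h
    have := hf i
    rw [h] at this
    simp [mdeg] at this
  have hmd : ∀ i, mdeg (f i) = (((f i).totalDegree : ℤ) : WithBot ℤ) := fun i => mdeg_eq _ (hne i)
  have hDfd : ∀ i k, DB (Df i k) (((f i).totalDegree : ℤ) - 1) := by
    intro i k
    have h := (hDf i).2 k
    rw [hmd] at h
    rw [← mdeg_le_iff]
    generalize mdeg (Df i k) = a at h ⊢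
    induction a using WithBot.recBotCoe with
    | bot => exact bot_le
    | coe a =>
      have h' : a + 1 ≤ ((f i).totalDegree : ℤ) := by exact_mod_cast h
      rw [WithBot.coe_le_coe]
      linarith
  obtain ⟨D, hD, hDd⟩ := koszul_sub (DF' - DF'') (by
    have h1 : ∑ k : Fin n, (X (Sum.inl k) - X (Sum.inr k)) * DF' k =
      ∑ k : Fin n, (X (Sum.inl k) - X (Sum.inr k)) * DF'' k := hDF'.trans hDF''.symm
    simp only [Pi.sub_apply, mul_sub, Finset.sum_sub_distrib] at h1 ⊢
    rw [h1, sub_self]) (d - 1)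
    (fun k => ((mdeg_le_iff _ _).1 (hdeg' k)).sub ((mdeg_le_iff _ _).1 (hdeg'' k)))
  rw [applyY_sub, ddetX_eq_bord, ddetX_eq_bord, bord_sub,
    bord_final (Matrix.of fun k i => Df i k) D (fun k => X (Sum.inl k) - X (Sum.inr k)) _ _ (fun i => toY (f i)) hD
      (fun l => (hDf l).1), applyY_sum]
  simp only [applyY_toX_mul]
  refine ⟨_, rfl, fun i => ?_⟩
  set M : Matrix (Fin n) (Fin n) (MvPolynomial (Fin n ⊕ Fin n) R) :=
    Matrix.of fun k i => Df i k with hM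
  have hB : ∀ l, DB (BB M D i l) (deltaF f + d - (f i).totalDegree - (f l).totalDegree) := by
    intro l
    refine (DB.BB (M := M) (c := fun i => ((f i).totalDegree : ℤ) - 1)
      (fun r i => hDfd i r) hDd i l).mono (le_of_eq ?_)
    unfold deltaF
    ring
  have hg : DB (applyY L (∑ l, toY (f l) * BB M D i l)) (d - δ - 1 - (f i).totalDegree) := by
    intro α hα
    by_contra hlt
    apply hα
    rw [coeff_applyY]
    apply hL
    refine ⟨fun l => coeff α (sumAlgEquiv R (Fin n) (Fin n) (BB M D i l)), ?_, fun l => ?_⟩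
    · rw [map_sum, coeff_sum]
      refine Finset.sum_congr rfl fun l _ => ?_
      rw [map_mul, sumAlgEquiv_toY, coeff_C_mul]
    · have h1 := ((hB l).coeff_sum α).mono
        (b := deltaF f + δ - (f l).totalDegree) (by linarith)
      rw [← mdeg_le_iff] at h1
      rw [hmd]
      refine (add_le_add_right h1 _).trans (le_of_eq ?_)
      rw [← WithBot.coe_add]
      congr 1
      ring
  rw [← mdeg_le_iff] at hg
  rw [hmd]
  refine (add_le_add_right hg _).trans (le_of_eq ?_)
  rw [← WithBot.coe_add]
  congr 1
  ring

end
end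

section
/- Let f = (f_1,…,f_n) be polynomials in R[x] with each deg f_i ≥ 1, δ_f = Σ_{i=1}^n (deg f_i − 1), and let δ ≥ 0 be an integer. Let L be an R-linear functional on R[x] that annuls (f)^{≤δ_f+δ}_x, and let F ∈ R[x] with deg F ≤ d. Fix a monotonous difference derivative ∇F of F, and let ∇'f_i and ∇''f_i be two systems of monotonous difference derivatives of the f_i. Then the polynomials H'(x) = L(y_*).det‖∇'f ∇F; f(x) F(x)‖ and H''(x) = L(y_*).det‖∇''f ∇F; f(x) F(x)‖ satisfy H'(x) − H''(x) ∈ (f)^{≤max(δ_f, d−δ−1)}_x. -/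
open MvPolynomial Finset

noncomputable section

variable {R : Type*} [CommRing R] {n : ℕ}

/-- `P` has total degree at most the integer `N`. -/
def DLe {σ S : Type*} [CommSemiring S] (P : MvPolynomial σ S) (N : ℤ) : Prop :=
  ∀ m, P.coeff m ≠ 0 → (m.degree : ℤ) ≤ N

section DLeLemmas

variable {σ : Type*} {S : Type*} [CommRing S]

theorem dle_iff (P : MvPolynomial σ S) (N : ℤ) : DLe P N ↔ mdeg P ≤ (N : WithBot ℤ) := by
  unfold DLe mdeg
  rw [Finset.sup_le_iff]
  refine forall_congr' fun m => ?_
  rw [mem_support_iff]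
  refine imp_congr Iff.rfl ?_
  change _ ↔ (((m.degree : ℤ) : WithBot ℤ) ≤ (N : WithBot ℤ))
  rw [WithBot.coe_le_coe]

theorem DLe.mono {P : MvPolynomial σ S} {N N' : ℤ} (h : DLe P N) (hN : N ≤ N') : DLe P N' :=
  fun m hm => (h m hm).trans hN

theorem DLe.zero (N : ℤ) : DLe (0 : MvPolynomial σ S) N := fun m hm => by simp at hm

theorem DLe.add {P Q : MvPolynomial σ S} {N : ℤ} (hP : DLe P N) (hQ : DLe Q N) :
    DLe (P + Q) N := by
  intro m hm
  rw [coeff_add] at hm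
  by_cases h : P.coeff m = 0
  · exact hQ m (by simpa [h] using hm)
  · exact hP m h

theorem DLe.neg {P : MvPolynomial σ S} {N : ℤ} (hP : DLe P N) : DLe (-P) N := by
  intro m hm
  exact hP m (by simpa using hm)

theorem DLe.sub {P Q : MvPolynomial σ S} {N : ℤ} (hP : DLe P N) (hQ : DLe Q N) :
    DLe (P - Q) N := by
  rw [sub_eq_add_neg]; exact hP.add hQ.neg

theorem DLe.sum {ι : Type*} {s : Finset ι} {P : ι → MvPolynomial σ S} {N : ℤ}
    (h : ∀ i ∈ s, DLe (P i) N) : DLe (∑ i ∈ s, P i) N := by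
  classical
  induction s using Finset.induction_on with
  | empty => simpa using DLe.zero N
  | insert a s ha ih =>
    rw [Finset.sum_insert ha]
    exact (h a (by simp)).add (ih fun i hi => h i (by simp [hi]))

theorem DLe.mul {P Q : MvPolynomial σ S} {N M : ℤ} (hP : DLe P N) (hQ : DLe Q M) :
    DLe (P * Q) (N + M) := by
  classical
  intro m hm
  have h := support_mul P Q (mem_support_iff.2 hm)
  obtain ⟨a, ha, b, hb, rfl⟩ := Finset.mem_add.1 h
  have h1 := hP a (mem_support_iff.1 ha)
  have h2 := hQ b (mem_support_iff.1 hb)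
  rw [map_add]
  push_cast
  linarith

theorem DLe.monomial (m : σ →₀ ℕ) (c : S) : DLe (monomial m c) (m.degree : ℤ) := by
  classical
  intro k hk
  rw [coeff_monomial] at hk
  split_ifs at hk with h
  · rw [h]
  · exact absurd rfl hk

theorem DLe.C (c : S) : DLe (C c : MvPolynomial σ S) 0 := by
  have := DLe.monomial (0 : σ →₀ ℕ) c
  simpa using this

theorem DLe.one : DLe (1 : MvPolynomial σ S) 0 := by
  simpa using DLe.C (σ := σ) (1 : S)

theorem DLe.X (v : σ) : DLe (X v : MvPolynomial σ S) 1 := by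
  have := DLe.monomial (Finsupp.single v 1) (1 : S)
  rw [Finsupp.degree_single] at this
  exact_mod_cast this

theorem DLe.prod {ι : Type*} {s : Finset ι} {P : ι → MvPolynomial σ S} {N : ι → ℤ}
    (h : ∀ i ∈ s, DLe (P i) (N i)) : DLe (∏ i ∈ s, P i) (∑ i ∈ s, N i) := by
  classical
  induction s using Finset.induction_on with
  | empty => simpa using DLe.one
  | insert a s ha ih =>
    rw [Finset.prod_insert ha, Finset.sum_insert ha]
    exact (h a (by simp)).mul (ih fun i hi => h i (by simp [hi]))

theorem DLe.eq_zero {P : MvPolynomial σ S} {N : ℤ} (h : DLe P N) (hN : N < 0) : P = 0 := by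
  ext m
  by_contra hm
  have := h m (by simpa using hm)
  have h2 : (0 : ℤ) ≤ (m.degree : ℤ) := Int.natCast_nonneg _
  linarith

theorem DLe.det {ι : Type*} [Fintype ι] [DecidableEq ι] {A : Matrix ι ι (MvPolynomial σ S)}
    {v w : ι → ℤ} (h : ∀ r s, DLe (A r s) (v r + w s)) :
    DLe A.det (∑ i, v i + ∑ i, w i) := by
  rw [Matrix.det_apply']
  refine DLe.sum fun τ _ => ?_
  have h1 : DLe (∏ i, A (τ i) i) (∑ i, v i + ∑ i, w i) := by
    have h2 := DLe.prod (s := Finset.univ) (fun i _ => h (τ i) i)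
    rw [Finset.sum_add_distrib, Equiv.sum_comp τ v] at h2
    exact h2
  rcases Int.units_eq_one_or (Equiv.Perm.sign τ) with h3 | h3
  · simpa [h3] using h1
  · simpa [h3] using h1.neg

end DLeLemmas

section ApplyYLemmas

variable (L : MvPolynomial (Fin n) R →ₗ[R] R)

/-- the monomial contribution -/
def applyTerm (m : Fin n ⊕ Fin n →₀ ℕ) (c : R) : MvPolynomial (Fin n) R :=
  C (L (monomial (Finsupp.sumFinsuppAddEquivProdFinsupp m).2 (1 : R)) * c) *
      monomial (Finsupp.sumFinsuppAddEquivProdFinsupp m).1 (1 : R)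

theorem applyY_eq_sum (P : MvPolynomial (Fin n ⊕ Fin n) R)
    (s : Finset (Fin n ⊕ Fin n →₀ ℕ)) (hs : P.support ⊆ s) :
    applyY L P = ∑ m ∈ s, applyTerm L m (P.coeff m) := by
  unfold applyY
  refine Finset.sum_subset hs fun m _ hm => ?_
  rw [notMem_support_iff.1 hm]
  simp

theorem applyY_add (P Q : MvPolynomial (Fin n ⊕ Fin n) R) :
    applyY L (P + Q) = applyY L P + applyY L Q := by
  classical
  rw [applyY_eq_sum L (P + Q) (P.support ∪ Q.support) support_add,
    applyY_eq_sum L P (P.support ∪ Q.support) Finset.subset_union_left,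
    applyY_eq_sum L Q (P.support ∪ Q.support) Finset.subset_union_right,
    ← Finset.sum_add_distrib]
  refine Finset.sum_congr rfl fun m _ => ?_
  simp only [applyTerm, coeff_add, mul_add, C_add, add_mul]

/-- `applyY` as an additive homomorphism. -/
def applyYHom : MvPolynomial (Fin n ⊕ Fin n) R →+ MvPolynomial (Fin n) R :=
  AddMonoidHom.mk' (applyY L) (applyY_add L)

theorem applyYHom_monomial (m : Fin n ⊕ Fin n →₀ ℕ) (c : R) :
    applyYHom L (monomial m c) = monomial (Finsupp.sumFinsuppAddEquivProdFinsupp m).1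
      (L (monomial (Finsupp.sumFinsuppAddEquivProdFinsupp m).2 c)) := by
  change applyY L _ = _
  rw [applyY_eq_sum L _ {m} support_monomial_subset, Finset.sum_singleton, applyTerm,
    coeff_monomial, if_pos rfl, C_mul_monomial, mul_one]
  congr 1
  rw [mul_comm, ← smul_eq_mul, ← map_smul, smul_monomial, smul_eq_mul, mul_one]

theorem toX_monomial (a : Fin n →₀ ℕ) (c : R) :
    toX (monomial a c) =
      monomial (Finsupp.sumFinsuppAddEquivProdFinsupp.symm (a, 0)) c := by
  rw [toX, rename_monomial]
  have h : Finsupp.mapDomain (Sum.inl : Fin n → Fin n ⊕ Fin n) a = Finsupp.sumFinsuppAddEquivProdFinsupp.symm (a, 0) := by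
    ext v
    rcases v with v | v
    · simp [Finsupp.mapDomain_apply Sum.inl_injective, Finsupp.mapDomain_of_notMem_range]
    · simp [Finsupp.mapDomain_apply Sum.inl_injective, Finsupp.mapDomain_of_notMem_range]
  rw [h]

theorem toY_monomial (a : Fin n →₀ ℕ) (c : R) :
    toY (monomial a c) =
      monomial (Finsupp.sumFinsuppAddEquivProdFinsupp.symm (0, a)) c := by
  rw [toY, rename_monomial]
  have h : Finsupp.mapDomain (Sum.inr : Fin n → Fin n ⊕ Fin n) a = Finsupp.sumFinsuppAddEquivProdFinsupp.symm (0, a) := by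
    ext v
    rcases v with v | v
    · simp [Finsupp.mapDomain_apply Sum.inr_injective, Finsupp.mapDomain_of_notMem_range]
    · simp [Finsupp.mapDomain_apply Sum.inr_injective, Finsupp.mapDomain_of_notMem_range]
  rw [h]

theorem applyYHom_toX_mul (G : MvPolynomial (Fin n) R) (P : MvPolynomial (Fin n ⊕ Fin n) R) :
    applyYHom L (toX G * P) = G * applyYHom L P := by
  induction G using MvPolynomial.induction_on' with
  | add p q hp hq => rw [map_add, add_mul, map_add, hp, hq, add_mul]
  | monomial a c =>
    induction P using MvPolynomial.induction_on' with
    | add p q hp hq => rw [mul_add, map_add, hp, hq, map_add, mul_add]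
    | monomial b e =>
      rw [toX_monomial, monomial_mul, applyYHom_monomial, applyYHom_monomial, monomial_mul]
      simp only [map_add, AddEquiv.apply_symm_apply, Prod.fst_add, Prod.snd_add, zero_add]
      congr 1
      rw [← smul_eq_mul c e, ← smul_eq_mul, ← map_smul, smul_monomial]

theorem applyYHom_toY_mul_monomial (f : MvPolynomial (Fin n) R)
    (m : Fin n ⊕ Fin n →₀ ℕ) (c : R) :
    applyYHom L (toY f * monomial m c) =
      monomial (Finsupp.sumFinsuppAddEquivProdFinsupp m).1
        (L (f * monomial (Finsupp.sumFinsuppAddEquivProdFinsupp m).2 c)) := by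
  induction f using MvPolynomial.induction_on' with
  | add p q hp hq => rw [map_add, add_mul, map_add, hp, hq, add_mul, map_add, map_add]
  | monomial a e =>
    rw [toY_monomial, monomial_mul, applyYHom_monomial, monomial_mul]
    simp only [map_add, AddEquiv.apply_symm_apply, Prod.fst_add, Prod.snd_add, zero_add]

theorem degree_split (m : Fin n ⊕ Fin n →₀ ℕ) :
    m.degree = (Finsupp.sumFinsuppAddEquivProdFinsupp m).1.degree +
      (Finsupp.sumFinsuppAddEquivProdFinsupp m).2.degree := by
  simp [Finsupp.degree_eq_sum]

theorem dle_applyYHom_toY_mul (F : MvPolynomial (Fin n) R)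
    (P : MvPolynomial (Fin n ⊕ Fin n) R) {N : ℤ} (hP : DLe P N) :
    DLe (applyYHom L (toY F * P)) N := by
  rw [P.as_sum, Finset.mul_sum, map_sum]
  refine DLe.sum fun m hm => ?_
  rw [applyYHom_toY_mul_monomial]
  refine (DLe.monomial _ _).mono ?_
  have h1 := hP m (mem_support_iff.1 hm)
  rw [degree_split] at h1
  push_cast at h1
  have h2 : (0 : ℤ) ≤ ((Finsupp.sumFinsuppAddEquivProdFinsupp m).2.degree : ℤ) :=
    Int.natCast_nonneg _
  linarith

theorem dle_applyYHom_annuls {K e : ℤ} (f : MvPolynomial (Fin n) R)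
    (hL : ∀ g, DLe g (K - e) → L (f * g) = 0)
    (P : MvPolynomial (Fin n ⊕ Fin n) R) {N : ℤ} (hP : DLe P N) :
    DLe (applyYHom L (toY f * P)) (N + e - K - 1) := by
  rw [P.as_sum, Finset.mul_sum, map_sum]
  refine DLe.sum fun m hm => ?_
  rw [applyYHom_toY_mul_monomial]
  have h1 := hP m (mem_support_iff.1 hm)
  rw [degree_split] at h1
  push_cast at h1
  by_cases h : ((Finsupp.sumFinsuppAddEquivProdFinsupp m).2.degree : ℤ) ≤ K - e
  · rw [hL _ ((DLe.monomial _ _).mono h), monomial_zero]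
    exact DLe.zero _
  · refine (DLe.monomial _ _).mono ?_
    push Not at h
    omega

end ApplyYLemmas

section Koszul

/-- `z_k = x_k - y_k`. -/
def zz (k : Fin n) : MvPolynomial (Fin n ⊕ Fin n) R := X (Sum.inl k) - X (Sum.inr k)

theorem dle_zz (k : Fin n) : DLe (zz k : MvPolynomial (Fin n ⊕ Fin n) R) 1 :=
  (DLe.X _).sub (DLe.X _)

theorem zz_mul_eq_zero (k : Fin n) (Q : MvPolynomial (Fin n ⊕ Fin n) R)
    (h : zz k * Q = 0) : Q = 0 := by
  classical
  let φ : MvPolynomial (Fin n ⊕ Fin n) R →ₐ[R] MvPolynomial (Fin n ⊕ Fin n) R :=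
    aeval (fun v => if v = Sum.inl k then X (Sum.inl k) + X (Sum.inr k) else X v)
  let ψ : MvPolynomial (Fin n ⊕ Fin n) R →ₐ[R] MvPolynomial (Fin n ⊕ Fin n) R :=
    aeval (fun v => if v = Sum.inl k then X (Sum.inl k) - X (Sum.inr k) else X v)
  have hc : ψ.comp φ = AlgHom.id R _ := by
    refine MvPolynomial.algHom_ext fun v => ?_
    by_cases hv : v = Sum.inl k
    · simp [φ, ψ, hv]
    · simp [φ, ψ, hv]
  have h1 : φ (zz k) = X (Sum.inl k) := by simp [φ, zz]
  have h2 : X (Sum.inl k) * φ Q = X (Sum.inl k) * 0 := by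
    rw [← h1, ← map_mul, h, map_zero, mul_zero]
  rw [X_mul_cancel_left_iff] at h2
  have h3 : ψ (φ Q) = Q := by
    rw [← AlgHom.comp_apply, hc, AlgHom.id_apply]
  rw [← h3, h2, map_zero]

/-- Substitution `x_j ↦ y_j` for `j ∈ s`. -/
def subY (s : Finset (Fin n)) :
    MvPolynomial (Fin n ⊕ Fin n) R →ₐ[R] MvPolynomial (Fin n ⊕ Fin n) R :=
  aeval (Sum.elim (fun j => if j ∈ s then X (Sum.inr j) else X (Sum.inl j))
    (fun j => X (Sum.inr j)))

/-- Divided difference property. -/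
def KP (s : Finset (Fin n)) (P : MvPolynomial (Fin n ⊕ Fin n) R) (N : ℤ) : Prop :=
  DLe P N ∧ DLe (subY s P) N ∧ ∃ b : Fin n → MvPolynomial (Fin n ⊕ Fin n) R,
    (∀ j, j ∉ s → b j = 0) ∧ (∀ j, DLe (b j) (N - 1)) ∧ P - subY s P = ∑ j, zz j * b j

theorem KP.mono {s : Finset (Fin n)} {P : MvPolynomial (Fin n ⊕ Fin n) R} {N N' : ℤ}
    (h : KP s P N) (hN : N ≤ N') : KP s P N' := by
  obtain ⟨h1, h2, b, hb, hd, he⟩ := h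
  exact ⟨h1.mono hN, h2.mono hN, b, hb, fun j => (hd j).mono (by linarith), he⟩

theorem KP.zero (s : Finset (Fin n)) (N : ℤ) :
    KP s (0 : MvPolynomial (Fin n ⊕ Fin n) R) N :=
  ⟨DLe.zero _, by rw [map_zero]; exact DLe.zero _, 0, fun _ _ => rfl, fun _ => DLe.zero _,
    by simp⟩

theorem KP.add {s : Finset (Fin n)} {P Q : MvPolynomial (Fin n ⊕ Fin n) R} {N : ℤ}
    (h : KP s P N) (h' : KP s Q N) : KP s (P + Q) N := by
  obtain ⟨h1, h2, b, hb, hd, he⟩ := h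
  obtain ⟨h1', h2', b', hb', hd', he'⟩ := h'
  refine ⟨h1.add h1', by rw [map_add]; exact h2.add h2', b + b', fun j hj => ?_,
    fun j => (hd j).add (hd' j), ?_⟩
  · simp [hb j hj, hb' j hj]
  · simp only [Pi.add_apply, mul_add, Finset.sum_add_distrib]
    rw [← he, ← he', map_add]; ring

theorem KP.mul {s : Finset (Fin n)} {P Q : MvPolynomial (Fin n ⊕ Fin n) R} {N M : ℤ}
    (h : KP s P N) (h' : KP s Q M) : KP s (P * Q) (N + M) := by
  obtain ⟨h1, h2, b, hb, hd, he⟩ := h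
  obtain ⟨h1', h2', b', hb', hd', he'⟩ := h'
  refine ⟨h1.mul h1', by rw [map_mul]; exact h2.mul h2',
    fun j => b j * Q + subY s P * b' j, fun j hj => ?_, fun j => ?_, ?_⟩
  · simp [hb j hj, hb' j hj]
  · exact (((hd j).mul h1').mono (by linarith)).add ((h2.mul (hd' j)).mono (by linarith))
  · have e1 : ∑ j, zz j * (b j * Q + subY s P * b' j) =
        (∑ j, zz j * b j) * Q + subY s P * ∑ j, zz j * b' j := by
      rw [Finset.sum_mul, Finset.mul_sum, ← Finset.sum_add_distrib]
      refine Finset.sum_congr rfl fun j _ => by ring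
    rw [e1, ← he, ← he', map_mul]; ring

theorem KP.C (s : Finset (Fin n)) (c : R) :
    KP s (C c : MvPolynomial (Fin n ⊕ Fin n) R) 0 := by
  have h : subY s (MvPolynomial.C c) = (MvPolynomial.C c : MvPolynomial (Fin n ⊕ Fin n) R) := by
    simp [subY, algebraMap_eq]
  refine ⟨DLe.C _, by rw [h]; exact DLe.C _, 0, fun _ _ => rfl, fun _ => DLe.zero _, ?_⟩
  rw [h]; simp

theorem KP.X (s : Finset (Fin n)) (v : Fin n ⊕ Fin n) :
    KP s (X v : MvPolynomial (Fin n ⊕ Fin n) R) 1 := by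
  classical
  by_cases hv : ∃ j ∈ s, v = Sum.inl j
  · obtain ⟨j, hj, rfl⟩ := hv
    have h : subY s (MvPolynomial.X (Sum.inl j)) =
        (MvPolynomial.X (Sum.inr j) : MvPolynomial (Fin n ⊕ Fin n) R) := by
      simp [subY, hj]
    refine ⟨DLe.X _, by rw [h]; exact DLe.X _, Pi.single j 1, fun i hi => ?_, fun i => ?_, ?_⟩
    · rw [Pi.single_eq_of_ne]; rintro rfl; exact hi hj
    · by_cases hij : i = j
      · subst hij; simpa using DLe.one
      · rw [Pi.single_eq_of_ne hij]; exact DLe.zero _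
    · rw [h, Finset.sum_eq_single j]
      · simp [zz]
      · intro i _ hij; simp [hij]
      · simp
  · have h : subY s (MvPolynomial.X v) =
        (MvPolynomial.X v : MvPolynomial (Fin n ⊕ Fin n) R) := by
      rcases v with v | v
      · have : v ∉ s := fun h => hv ⟨v, h, rfl⟩
        simp [subY, this]
      · simp [subY]
    refine ⟨DLe.X _, by rw [h]; exact DLe.X _, 0, fun _ _ => rfl, fun _ => DLe.zero _, ?_⟩
    rw [h]; simp

theorem KP.monomial (s : Finset (Fin n)) (m : Fin n ⊕ Fin n →₀ ℕ) :
    ∀ c : R, KP s (monomial m c) (m.degree : ℤ) := by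
  induction m using Finsupp.induction_linear with
  | zero => intro c; simpa using KP.C s c
  | add a b ha hb =>
    intro c
    have h := (ha c).mul (hb 1)
    rw [monomial_mul, mul_one] at h
    rw [map_add]; push_cast; exact h
  | single v e =>
    intro c
    induction e with
    | zero => simpa using KP.C s c
    | succ e ih =>
      have h := ih.mul (KP.X s v)
      rw [MvPolynomial.X, monomial_mul, mul_one, ← Finsupp.single_add] at h
      rw [Finsupp.degree_single] at h ⊢
      push_cast; exact h

theorem KP.of_dle (s : Finset (Fin n)) {P : MvPolynomial (Fin n ⊕ Fin n) R} {N : ℤ}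
    (h : DLe P N) : KP s P N := by
  have key : ∀ t : Finset (Fin n ⊕ Fin n →₀ ℕ), (∀ m ∈ t, (m.degree : ℤ) ≤ N) →
      KP s (∑ m ∈ t, MvPolynomial.monomial m (P.coeff m)) N := by
    classical
    intro t
    induction t using Finset.induction_on with
    | empty => intro _; simpa using KP.zero s N
    | insert a t ha ih =>
      intro ht
      rw [Finset.sum_insert ha]
      exact ((KP.monomial s a _).mono (ht a (by simp))).add (ih fun m hm => ht m (by simp [hm]))
  rw [P.as_sum]
  exact key _ fun m hm => h m (mem_support_iff.1 hm)

theorem subY_zz_mem (s : Finset (Fin n)) {j : Fin n} (hj : j ∈ s) :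
    subY s (zz j : MvPolynomial (Fin n ⊕ Fin n) R) = 0 := by
  simp [subY, zz, hj]

theorem subY_zz_not_mem (s : Finset (Fin n)) {j : Fin n} (hj : j ∉ s) :
    subY s (zz j : MvPolynomial (Fin n ⊕ Fin n) R) = zz j := by
  simp [subY, zz, hj]

theorem koszul_aux (N : ℤ) (s : Finset (Fin n)) :
    ∀ u : Fin n → MvPolynomial (Fin n ⊕ Fin n) R, (∀ k, k ∉ s → u k = 0) →
      (∀ k, DLe (u k) N) → ∑ k, zz k * u k = 0 →
      ∃ a : Fin n → Fin n → MvPolynomial (Fin n ⊕ Fin n) R,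
        (∀ j k, DLe (a j k) (N - 1)) ∧ ∀ k, u k = ∑ j, zz j * (a j k - a k j) := by
  classical
  induction s using Finset.induction_on with
  | empty =>
    intro u hu _ _
    exact ⟨0, fun _ _ => DLe.zero _, fun k => by simp [hu k (by simp)]⟩
  | insert p s hp ih =>
    intro u hu hd h0
    obtain ⟨-, -, b, hb, hbd, hbe⟩ := KP.of_dle s (hd p)
    have h1 : subY s (u p) = 0 := by
      apply zz_mul_eq_zero p
      have h2 := congrArg (subY s) h0
      rw [map_sum, map_zero, Finset.sum_eq_single p] at h2
      · rwa [map_mul, subY_zz_not_mem s hp] at h2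
      · intro k _ hk
        rw [map_mul]
        by_cases hks : k ∈ s
        · rw [subY_zz_mem s hks, zero_mul]
        · rw [hu k (by simp [hk, hks]), map_zero, mul_zero]
      · simp
    rw [h1, sub_zero] at hbe
    have hbp : b p = 0 := hb p hp
    obtain ⟨a, had, hae⟩ := ih (fun k => if k = p then 0 else u k + zz p * b k)
      (by
        intro k hk
        by_cases hkp : k = p
        · simp [hkp]
        · simp [hkp, hb k hk, hu k (by simp [hkp, hk])])
      (by
        intro k
        by_cases hkp : k = p
        · simp only [hkp, if_true]; exact DLe.zero _
        · simp only [hkp, if_false]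
          exact (hd k).add (((dle_zz p).mul (hbd k)).mono (by linarith)))
      (by
        have e : ∀ k, zz k * (if k = p then 0 else u k + zz p * b k) =
            zz k * u k + zz p * (zz k * b k) - (if k = p then zz p * u p else 0) := by
          intro k
          by_cases hkp : k = p
          · subst hkp; simp [hbp]
          · simp [hkp]; ring
        simp only [e]
        rw [Finset.sum_sub_distrib, Finset.sum_add_distrib, h0, ← Finset.mul_sum, ← hbe]
        simp)
    refine ⟨fun j k => a j k + if k = p then b j else 0, fun j k => ?_, fun k => ?_⟩
    · refine (had j k).add ?_
      split_ifs
      · exact hbd j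
      · exact DLe.zero _
    · have e : ∀ j, zz j * ((a j k + if k = p then b j else 0) -
            (a k j + if j = p then b k else 0)) =
          zz j * (a j k - a k j) + (if k = p then zz j * b j else 0) -
            (if j = p then zz p * b k else 0) := by
        intro j
        by_cases hkp : k = p <;> by_cases hjp : j = p <;> simp [hkp, hjp] <;> ring
      simp only [e]
      rw [Finset.sum_sub_distrib, Finset.sum_add_distrib, ← hae k]
      by_cases hkp : k = p
      · subst hkp
        simp [hbp, ← hbe]
      · simp [hkp]

end Koszul

section Det

variable {A : Type*} [CommRing A] {m : ℕ}

/-- Replacing column `c` by `u`. -/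
theorem det_updateCol_adj {ι : Type*} [Fintype ι] [DecidableEq ι] (M : Matrix ι ι A) (c : ι)
    (u : ι → A) : (M.updateCol c u).det = ∑ k, u k * (M.updateRow k (Pi.single c 1)).det := by
  rw [← Matrix.cramer_apply, Matrix.cramer_eq_adjugate_mulVec, Matrix.mulVec, dotProduct]
  refine Finset.sum_congr rfl fun k _ => ?_
  rw [Matrix.adjugate_apply, mul_comm]

/-- Row expansion. -/
theorem det_updateRow_expand {ι κ : Type*} [Fintype ι] [DecidableEq ι] (M : Matrix ι ι A) (r : ι)
    (s : Finset κ) (t : κ → A) (v : κ → ι → A) :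
    (M.updateRow r (∑ p ∈ s, t p • v p)).det = ∑ p ∈ s, t p * (M.updateRow r (v p)).det := by
  simp only [← Matrix.cramer_transpose_apply]
  simp

theorem det_koszul {ι : Type*} [Fintype ι] [DecidableEq ι] (M : Matrix ι ι A) (c j k : ι)
    (hjk : j ≠ k) (z : ι → A) :
    z j * (M.updateRow k (Pi.single c 1)).det - z k * (M.updateRow j (Pi.single c 1)).det =
      ((M.updateRow k (Pi.single c 1)).updateRow j (∑ l, z l • M.row l)).det := by
  rw [det_updateRow_expand, ← Finset.add_sum_erase _ _ (Finset.mem_univ j),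
    ← Finset.add_sum_erase _ _ (Finset.mem_erase.2 ⟨hjk.symm, Finset.mem_univ k⟩),
    Finset.sum_eq_zero]
  · have h1 : (M.updateRow k (Pi.single c 1)).updateRow j (M.row j) =
        M.updateRow k (Pi.single c 1) := by
      ext r s
      by_cases hr : r = j
      · subst hr; simp [Matrix.updateRow_apply, hjk]
      · simp [Matrix.updateRow_apply, hr]
    have h2 : ((M.updateRow k (Pi.single c 1)).updateRow j (M.row k)).det =
        -(M.updateRow j (Pi.single c 1)).det := by
      have h3 : (M.updateRow k (Pi.single c 1)).updateRow j (M.row k) =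
          (M.updateRow j (Pi.single c 1)).submatrix (Equiv.swap j k) id := by
        ext r s
        by_cases hr : r = j
        · subst hr; simp [Matrix.updateRow_apply, hjk.symm]
        · by_cases hr' : r = k
          · subst hr'; simp [Matrix.updateRow_apply, hr]
          · simp [Matrix.updateRow_apply, hr, hr', Equiv.swap_apply_of_ne_of_ne hr hr']
      rw [h3, Matrix.det_permute, Equiv.Perm.sign_swap hjk]
      simp
    rw [h1, h2]; ring
  · intro l hl
    simp only [Finset.mem_erase, Finset.mem_univ, and_true] at hl
    rw [Matrix.det_zero_of_row_eq hl.2.symm, mul_zero]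
    ext s
    simp [Matrix.updateRow_apply, hl.1, hl.2]

end Det

section Main

/-- Uniform description of the matrix. -/
def Mat (g : Fin (n + 1) → MvPolynomial (Fin n) R)
    (Dg : Fin (n + 1) → Fin n → MvPolynomial (Fin n ⊕ Fin n) R) :
    Matrix (Fin (n + 1)) (Fin (n + 1)) (MvPolynomial (Fin n ⊕ Fin n) R) :=
  Matrix.of fun k i => (Fin.snoc (α := fun _ => MvPolynomial (Fin n ⊕ Fin n) R) (Dg i) (toX (g i)) :
    Fin (n + 1) → _) k

theorem Mat_castSucc (g : Fin (n + 1) → MvPolynomial (Fin n) R)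
    (Dg : Fin (n + 1) → Fin n → MvPolynomial (Fin n ⊕ Fin n) R) (k : Fin n) (i : Fin (n + 1)) :
    Mat g Dg k.castSucc i = Dg i k := by
  simp [Mat]

theorem Mat_last (g : Fin (n + 1) → MvPolynomial (Fin n) R)
    (Dg : Fin (n + 1) → Fin n → MvPolynomial (Fin n ⊕ Fin n) R) (i : Fin (n + 1)) :
    Mat g Dg (Fin.last n) i = toX (g i) := by
  simp [Mat]

/-- `f` extended by `F` in the last place. -/
def ext1 {T : Type*} (f : Fin n → T) (F : T) : Fin (n + 1) → T := Fin.snoc (α := fun _ => T) f F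

@[simp] theorem ext1_castSucc {T : Type*} (f : Fin n → T) (F : T) (i : Fin n) :
    ext1 f F i.castSucc = f i := by simp [ext1]

@[simp] theorem ext1_last {T : Type*} (f : Fin n → T) (F : T) :
    ext1 f F (Fin.last n) = F := by simp [ext1]

theorem ddetX_eq (f : Fin n → MvPolynomial (Fin n) R)
    (Df : Fin n → Fin n → MvPolynomial (Fin n ⊕ Fin n) R)
    (F : MvPolynomial (Fin n) R) (DF : Fin n → MvPolynomial (Fin n ⊕ Fin n) R) :
    ddetX f Df F DF = (Mat (ext1 f F) (ext1 Df DF)).det := by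
  unfold ddetX
  congr 1
  ext1 k i
  induction k using Fin.lastCases with
  | last =>
    rw [Mat_last]
    induction i using Fin.lastCases with
    | last => simp
    | cast i => simp
  | cast k =>
    rw [Mat_castSucc]
    induction i using Fin.lastCases with
    | last => simp
    | cast i => simp

/-- The determinant with three rows replaced by unit vectors. -/
def TT (M : Matrix (Fin (n + 1)) (Fin (n + 1)) (MvPolynomial (Fin n ⊕ Fin n) R))
    (c : Fin (n + 1)) (j k : Fin n) (p q : Fin (n + 1)) : MvPolynomial (Fin n ⊕ Fin n) R :=
  (((M.updateRow k.castSucc (Pi.single c 1)).updateRow j.castSucc (Pi.single p 1)).updateRow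
    (Fin.last n) (Pi.single q 1)).det

theorem dle_single {ι σ : Type*} [DecidableEq ι] (w : ι → ℤ) (c s : ι) :
    DLe ((Pi.single c 1 : ι → MvPolynomial σ R) s) (-w c + w s) := by
  by_cases h : s = c
  · subst h; simpa using DLe.one
  · rw [Pi.single_eq_of_ne h]; exact DLe.zero _

theorem TT_dle (g : Fin (n + 1) → MvPolynomial (Fin n) R)
    (Dg : Fin (n + 1) → Fin n → MvPolynomial (Fin n ⊕ Fin n) R)
    (w : Fin (n + 1) → ℤ) (hD : ∀ i k, DLe (Dg i k) (w i))
    (c : Fin (n + 1)) (j k : Fin n) (hjk : j ≠ k) (p q : Fin (n + 1)) :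
    DLe (TT (Mat g Dg) c j k p q) (∑ i, w i - w c - w p - w q) := by
  let v : Fin (n + 1) → ℤ := Pi.single k.castSucc (-w c) + Pi.single j.castSucc (-w p) +
    Pi.single (Fin.last n) (-w q)
  have hv : ∑ i, v i = -w c - w p - w q := by
    simp only [v, Pi.add_apply, Finset.sum_add_distrib, Finset.sum_pi_single',
      Finset.mem_univ, if_true]
    ring
  have hjk' : j.castSucc ≠ k.castSucc := fun h => hjk (Fin.castSucc_injective _ h)
  have e : ∑ i, w i - w c - w p - w q = ∑ i, v i + ∑ i, w i := by rw [hv]; ring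
  rw [e]
  refine DLe.det fun r s => ?_
  induction r using Fin.lastCases with
  | last =>
    have : v (Fin.last n) = -w q := by
      simp [v, Pi.single_apply, (Fin.castSucc_lt_last _).ne']
    rw [Matrix.updateRow_self, this]
    exact dle_single w q s
  | cast r =>
    rw [Matrix.updateRow_ne (Fin.castSucc_lt_last _).ne]
    by_cases hr : r = j
    · subst hr
      have : v r.castSucc = -w p := by
        simp [v, Pi.single_apply, (Fin.castSucc_lt_last _).ne, hjk]
      rw [Matrix.updateRow_self, this]
      exact dle_single w p s
    · rw [Matrix.updateRow_ne (fun h => hr (Fin.castSucc_injective _ h))]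
      by_cases hr' : r = k
      · subst hr'
        have : v r.castSucc = -w c := by
          simp [v, Pi.single_apply, (Fin.castSucc_lt_last _).ne, hr]
        rw [Matrix.updateRow_self, this]
        exact dle_single w c s
      · rw [Matrix.updateRow_ne (fun h => hr' (Fin.castSucc_injective _ h)), Mat_castSucc]
        have : v r.castSucc = 0 := by
          simp [v, Pi.single_apply, (Fin.castSucc_lt_last _).ne, hr, hr']
        rw [this, zero_add]
        exact hD s r

theorem TT_last (M : Matrix (Fin (n + 1)) (Fin (n + 1)) (MvPolynomial (Fin n ⊕ Fin n) R))
    (c : Fin (n + 1)) (j k : Fin n) (p : Fin (n + 1)) : TT M c j k p p = 0 := by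
  unfold TT
  rw [Matrix.det_zero_of_row_eq (Fin.castSucc_lt_last j).ne]
  ext1 s
  rw [Matrix.updateRow_ne (Fin.castSucc_lt_last _).ne, Matrix.updateRow_self,
    Matrix.updateRow_self]

theorem koszul_det (g : Fin (n + 1) → MvPolynomial (Fin n) R)
    (Dg : Fin (n + 1) → Fin n → MvPolynomial (Fin n ⊕ Fin n) R)
    (hD : ∀ i, IsDiffDeriv (g i) (Dg i)) (c : Fin (n + 1)) (j k : Fin n) (hjk : j ≠ k) :
    zz j * ((Mat g Dg).updateRow k.castSucc (Pi.single c 1)).det -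
      zz k * ((Mat g Dg).updateRow j.castSucc (Pi.single c 1)).det =
    -∑ p, ∑ q, toY (g p) * (toX (g q) * TT (Mat g Dg) c j k p q) := by
  have hjk' : j.castSucc ≠ k.castSucc := fun h => hjk (Fin.castSucc_injective _ h)
  have h1 := det_koszul (Mat g Dg) c j.castSucc k.castSucc hjk' (ext1 zz 0)
  rw [ext1_castSucc, ext1_castSucc] at h1
  rw [h1]
  have h2 : (∑ l, (ext1 zz 0 : Fin (n + 1) → MvPolynomial (Fin n ⊕ Fin n) R) l •
      (Mat g Dg).row l) = (fun s => toX (g s)) +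
        ∑ p, (-toY (g p)) • (Pi.single p 1 : Fin (n + 1) → MvPolynomial (Fin n ⊕ Fin n) R) := by
    ext1 s
    have h3 := hD s
    unfold IsDiffDeriv at h3
    rw [Fin.sum_univ_castSucc]
    simp only [Pi.add_apply, Finset.sum_apply, Pi.smul_apply, smul_eq_mul, ext1_castSucc,
      ext1_last, zero_mul, add_zero, Matrix.row, Mat_castSucc, zero_smul, Pi.single_apply]
    simp only [zz, mul_ite, mul_one, mul_zero, Finset.sum_ite_eq, Finset.mem_univ, if_true]
    rw [h3, Pi.zero_apply]; ring
  rw [h2, Matrix.det_updateRow_add, det_updateRow_expand,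
    Matrix.det_zero_of_row_eq (Fin.castSucc_lt_last j).ne, zero_add, ← Finset.sum_neg_distrib]
  · refine Finset.sum_congr rfl fun p _ => ?_
    rw [← Finset.mul_sum, neg_mul]
    congr 2
    simp only [TT]
    rw [← det_updateRow_expand]
    congr 1
    ext1 r s
    induction r using Fin.lastCases with
    | last =>
      rw [Matrix.updateRow_ne (Fin.castSucc_lt_last _).ne',
        Matrix.updateRow_ne (Fin.castSucc_lt_last _).ne', Matrix.updateRow_self, Mat_last]
      simp [Finset.sum_apply, Pi.single_apply]
    | cast r => rw [Matrix.updateRow_ne (Fin.castSucc_lt_last r).ne]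
  · ext1 s
    rw [Matrix.updateRow_self, Matrix.updateRow_ne (Fin.castSucc_lt_last _).ne',
        Matrix.updateRow_ne (Fin.castSucc_lt_last _).ne', Mat_last]

/-- Convenient form of `boundedSpan`, with `e i = deg f_i`. -/
def BS (f : Fin n → MvPolynomial (Fin n) R) (e : Fin n → ℤ) (D : ℤ) :
    AddSubgroup (MvPolynomial (Fin n) R) where
  carrier := {F | ∃ g : Fin n → MvPolynomial (Fin n) R,
    F = ∑ i, f i * g i ∧ ∀ i, DLe (g i) (D - e i)}
  zero_mem' := ⟨0, by simp, fun _ => DLe.zero _⟩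
  add_mem' := by
    rintro _ _ ⟨g, rfl, hg⟩ ⟨g', rfl, hg'⟩
    refine ⟨g + g', ?_, fun i => (hg i).add (hg' i)⟩
    simp [mul_add, Finset.sum_add_distrib]
  neg_mem' := by
    rintro _ ⟨g, rfl, hg⟩
    refine ⟨-g, ?_, fun i => (hg i).neg⟩
    simp

theorem BS_single (f : Fin n → MvPolynomial (Fin n) R) (e : Fin n → ℤ) (D : ℤ) (q : Fin n)
    (G : MvPolynomial (Fin n) R) (hG : DLe G (D - e q)) : f q * G ∈ BS f e D := by
  refine ⟨Pi.single q G, ?_, fun i => ?_⟩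
  · rw [Finset.sum_eq_single q]
    · simp
    · intro i _ hi; simp [hi]
    · simp
  · by_cases hi : i = q
    · subst hi; simpa using hG
    · rw [Pi.single_eq_of_ne hi]; exact DLe.zero _

theorem term_mem (f : Fin n → MvPolynomial (Fin n) R) (F : MvPolynomial (Fin n) R)
    (e : Fin n → ℤ) (d δ : ℤ) (hδ : 0 ≤ δ) (L : MvPolynomial (Fin n) R →ₗ[R] R)
    (hL : ∀ p g, DLe g (∑ i, (e i - 1) + δ - e p) → L (f p * g) = 0)
    (Dg : Fin (n + 1) → Fin n → MvPolynomial (Fin n ⊕ Fin n) R)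
    (hd : ∀ i k, DLe (Dg i k) (ext1 (fun i => e i - 1) (d - 1) i))
    (c j k : Fin n) (hjk : j ≠ k) (p q : Fin (n + 1)) (a : MvPolynomial (Fin n ⊕ Fin n) R)
    (ha : DLe a (e c - 1 - 1)) :
    applyYHom L (a * (toY (ext1 f F p) * (toX (ext1 f F q) *
      TT (Mat (ext1 f F) Dg) c.castSucc j k p q))) ∈
        BS f e (max (∑ i, (e i - 1)) (d - δ - 1)) := by
  have hT := TT_dle (ext1 f F) Dg (ext1 (fun i => e i - 1) (d - 1)) hd c.castSucc j k hjk p q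
  set T := TT (Mat (ext1 f F) Dg) c.castSucc j k p q with hTdef
  have hT' := ha.mul hT
  rw [Fin.sum_univ_castSucc] at hT'
  simp only [ext1_castSucc, ext1_last] at hT'
  have e1 : a * (toY (ext1 f F p) * (toX (ext1 f F q) * T)) =
      toX (ext1 f F q) * (toY (ext1 f F p) * (a * T)) := by ring
  rw [e1, applyYHom_toX_mul]
  have m1 := le_max_left (∑ i, (e i - 1)) (d - δ - 1)
  have m2 := le_max_right (∑ i, (e i - 1)) (d - δ - 1)
  induction p using Fin.lastCases with
  | last =>
    induction q using Fin.lastCases with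
    | last =>
      rw [hTdef, TT_last, mul_zero, mul_zero, map_zero, mul_zero]
      exact zero_mem _
    | cast q =>
      simp only [ext1_castSucc, ext1_last] at hT' ⊢
      refine BS_single _ _ _ _ _ ((dle_applyYHom_toY_mul L F _ hT').mono ?_)
      linarith
  | cast p =>
    have h := fun N hN => dle_applyYHom_annuls L (f p) (hL p) (a * T) (N := N) hN
    simp only [ext1_castSucc] at hT' ⊢
    have h' := h _ hT'
    induction q using Fin.lastCases with
    | last =>
      simp only [ext1_last] at h' ⊢
      rw [h'.eq_zero (by linarith), mul_zero]
      exact zero_mem _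
    | cast q =>
      simp only [ext1_castSucc] at h' ⊢
      refine BS_single _ _ _ _ _ (h'.mono ?_)
      linarith

theorem step_mem (f : Fin n → MvPolynomial (Fin n) R) (F : MvPolynomial (Fin n) R)
    (e : Fin n → ℤ) (d δ : ℤ) (hδ : 0 ≤ δ) (L : MvPolynomial (Fin n) R →ₗ[R] R)
    (hL : ∀ p g, DLe g (∑ i, (e i - 1) + δ - e p) → L (f p * g) = 0)
    (DF : Fin n → MvPolynomial (Fin n ⊕ Fin n) R) (hDF : IsDiffDeriv F DF)
    (hDFd : ∀ k, DLe (DF k) (d - 1))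
    (Df : Fin n → Fin n → MvPolynomial (Fin n ⊕ Fin n) R) (hDf : ∀ i, IsDiffDeriv (f i) (Df i))
    (hDfd : ∀ i k, DLe (Df i k) (e i - 1))
    (c : Fin n) (Dc : Fin n → MvPolynomial (Fin n ⊕ Fin n) R) (hDc : IsDiffDeriv (f c) Dc)
    (hDcd : ∀ k, DLe (Dc k) (e c - 1)) :
    applyYHom L (ddetX f (Function.update Df c Dc) F DF) - applyYHom L (ddetX f Df F DF) ∈
        BS f e (max (∑ i, (e i - 1)) (d - δ - 1)) := by
  rw [← map_sub, ddetX_eq, ddetX_eq]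
  set M := Mat (ext1 f F) (ext1 Df DF) with hM
  have hg : ∀ i, IsDiffDeriv (ext1 f F i) (ext1 Df DF i) := by
    intro i
    induction i using Fin.lastCases with
    | last => simpa using hDF
    | cast i => simpa using hDf i
  have hgd : ∀ i k, DLe (ext1 Df DF i k) (ext1 (fun i => e i - 1) (d - 1) i) := by
    intro i
    induction i using Fin.lastCases with
    | last => simpa using hDFd
    | cast i => simpa using hDfd i
  let u : Fin n → MvPolynomial (Fin n ⊕ Fin n) R := fun k => Dc k - Df c k
  have hu : ∑ k, zz k * u k = 0 := by
    simp only [u, mul_sub, Finset.sum_sub_distrib]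
    have h1 := hDc
    have h2 := hDf c
    unfold IsDiffDeriv at h1 h2
    simp only [zz]
    rw [h1, h2, sub_self]
  obtain ⟨a, had, hae⟩ := koszul_aux (e c - 1) Finset.univ u (fun k hk => by simp at hk)
    (fun k => (hDcd k).sub (hDfd c k)) hu
  have h1 : Mat (ext1 f F) (ext1 (Function.update Df c Dc) DF) =
      M.updateCol c.castSucc ((fun r => M r c.castSucc) + ext1 u 0) := by
    ext1 r s
    by_cases hs : s = c.castSucc
    · subst hs
      rw [Matrix.updateCol_self]
      induction r using Fin.lastCases with
      | last => simp [hM, Mat_last]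
      | cast r => simp [hM, Mat_castSucc, u]
    · rw [Matrix.updateCol_ne hs]
      induction r using Fin.lastCases with
      | last => simp [hM, Mat_last]
      | cast r =>
        rw [hM, Mat_castSucc, Mat_castSucc]
        induction s using Fin.lastCases with
        | last => simp
        | cast s =>
          have : s ≠ c := fun h => hs (by rw [h])
          simp [this]
  have h2 : (Mat (ext1 f F) (ext1 (Function.update Df c Dc) DF)).det - M.det =
      ∑ j, ∑ k, a j k * (zz j * (M.updateRow k.castSucc (Pi.single c.castSucc 1)).det -
        zz k * (M.updateRow j.castSucc (Pi.single c.castSucc 1)).det) := by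
    rw [h1, Matrix.det_updateCol_add]
    have h3 : M.updateCol c.castSucc (fun r => M r c.castSucc) = M := by
      ext r s
      by_cases hs : s = c.castSucc
      · subst hs; simp
      · simp [hs]
    rw [h3, add_sub_cancel_left, det_updateCol_adj, Fin.sum_univ_castSucc]
    simp only [ext1_castSucc, ext1_last, zero_mul, add_zero]
    simp only [mul_sub, Finset.sum_sub_distrib]
    rw [Finset.sum_comm (f := fun j k => a j k * (zz j *
      (M.updateRow k.castSucc (Pi.single c.castSucc 1)).det)), ← Finset.sum_sub_distrib]
    refine Finset.sum_congr rfl fun k _ => ?_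
    rw [hae k, Finset.sum_mul, ← Finset.sum_sub_distrib]
    refine Finset.sum_congr rfl fun j _ => ?_
    ring
  rw [h2, map_sum]
  refine sum_mem fun j _ => ?_
  rw [map_sum]
  refine sum_mem fun k _ => ?_
  by_cases hjk : j = k
  · subst hjk
    rw [sub_self, mul_zero, map_zero]
    exact zero_mem _
  · rw [hM, koszul_det _ _ hg _ _ _ hjk, mul_neg, map_neg]
    refine neg_mem ?_
    rw [Finset.mul_sum, map_sum]
    refine sum_mem fun p _ => ?_
    rw [Finset.mul_sum, map_sum]
    refine sum_mem fun q _ => ?_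
    exact term_mem f F e d δ hδ L hL _ hgd c j k hjk p q _ (had j k)

theorem total_mem (f : Fin n → MvPolynomial (Fin n) R) (F : MvPolynomial (Fin n) R)
    (e : Fin n → ℤ) (d δ : ℤ) (hδ : 0 ≤ δ) (L : MvPolynomial (Fin n) R →ₗ[R] R)
    (hL : ∀ p g, DLe g (∑ i, (e i - 1) + δ - e p) → L (f p * g) = 0)
    (DF : Fin n → MvPolynomial (Fin n ⊕ Fin n) R) (hDF : IsDiffDeriv F DF)
    (hDFd : ∀ k, DLe (DF k) (d - 1))
    (Df Df' : Fin n → Fin n → MvPolynomial (Fin n ⊕ Fin n) R)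
    (hDf : ∀ i, IsDiffDeriv (f i) (Df i)) (hDfd : ∀ i k, DLe (Df i k) (e i - 1))
    (hDf' : ∀ i, IsDiffDeriv (f i) (Df' i)) (hDfd' : ∀ i k, DLe (Df' i k) (e i - 1)) :
    applyYHom L (ddetX f Df' F DF) - applyYHom L (ddetX f Df F DF) ∈
        BS f e (max (∑ i, (e i - 1)) (d - δ - 1)) := by
  classical
  have key : ∀ s : Finset (Fin n),
      applyYHom L (ddetX f (s.piecewise Df' Df) F DF) - applyYHom L (ddetX f Df F DF) ∈
        BS f e (max (∑ i, (e i - 1)) (d - δ - 1)) := by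
    intro s
    induction s using Finset.induction_on with
    | empty => rw [Finset.piecewise_empty, sub_self]; exact zero_mem _
    | insert c s hc ih =>
      rw [Finset.piecewise_insert]
      have h := step_mem f F e d δ hδ L hL DF hDF hDFd (s.piecewise Df' Df)
        (fun i => by by_cases hi : i ∈ s <;> simp [hi, hDf, hDf'])
        (fun i k => by by_cases hi : i ∈ s <;> simp [hi, hDfd, hDfd'])
        c (Df' c) (hDf' c) (hDfd' c)
      have := add_mem h ih
      rwa [sub_add_sub_cancel] at this
  have := key Finset.univ
  rwa [Finset.piecewise_univ] at this

theorem mdeg_eq_totalDegree {P : MvPolynomial (Fin n) R} (h : (1 : WithBot ℤ) ≤ mdeg P) :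
    mdeg P = (((P.totalDegree : ℕ) : ℤ) : WithBot ℤ) := by
  have hP : P.support.Nonempty := by
    rw [Finset.nonempty_iff_ne_empty]
    intro h0
    rw [mdeg, h0, Finset.sup_empty] at h
    exact absurd h (by simp)
  apply le_antisymm
  · rw [← dle_iff]
    intro m hm
    exact_mod_cast le_totalDegree (mem_support_iff.2 hm)
  · obtain ⟨m, hm, he⟩ := Finset.exists_mem_eq_sup P.support hP (fun m => m.sum fun _ e => e)
    have e1 : P.totalDegree = m.sum fun _ e => e := he
    rw [e1]
    exact Finset.le_sup (f := fun m : Fin n →₀ ℕ =>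
      (((m.sum fun _ e => e : ℕ) : ℤ) : WithBot ℤ)) hm

theorem coe_add_le_iff (a D : ℤ) (x : WithBot ℤ) :
    (a : WithBot ℤ) + x ≤ (D : WithBot ℤ) ↔ x ≤ ((D - a : ℤ) : WithBot ℤ) := by
  induction x with
  | bot => simp
  | coe x =>
    rw [← WithBot.coe_add, WithBot.coe_le_coe, WithBot.coe_le_coe]
    constructor <;> intro h <;> linarith

theorem mem_boundedSpan_iff (f : Fin n → MvPolynomial (Fin n) R)
    (hf : ∀ i, (1 : WithBot ℤ) ≤ mdeg (f i)) (D : ℤ) (P : MvPolynomial (Fin n) R) :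
    P ∈ boundedSpan f (D : WithBot ℤ) ↔ P ∈ BS f (fun i => ((f i).totalDegree : ℤ)) D := by
  change (∃ g : Fin n → MvPolynomial (Fin n) R, _) ↔ (∃ g : Fin n → MvPolynomial (Fin n) R, _)
  refine exists_congr fun g => and_congr Iff.rfl (forall_congr' fun i => ?_)
  rw [mdeg_eq_totalDegree (hf i), coe_add_le_iff, dle_iff]

theorem dle_of_add_one_le {σ : Type*} {P : MvPolynomial σ R} {D : ℤ}
    (h : mdeg P + 1 ≤ (D : WithBot ℤ)) : DLe P (D - 1) := by
  rw [dle_iff, ← coe_add_le_iff, add_comm]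
  exact h

end Main

/-- Theorem 2.2, second part: `H(x)` is determined up to an addend in
`(f)^{≤ max(δ_f, d - δ - 1)}_x` independently of the choice of the `∇fᵢ`. -/
theorem applyY_ddetX_sub_of_Df {R : Type*} [CommRing R] {n : ℕ}
    (f : Fin n → MvPolynomial (Fin n) R) (hf : ∀ i, (1 : WithBot ℤ) ≤ mdeg (f i))
    (δ : ℤ) (hδ : 0 ≤ δ) (L : MvPolynomial (Fin n) R →ₗ[R] R)
    (hL : Annuls L (boundedSpan f ((deltaF f + δ : ℤ) : WithBot ℤ)))
    (d : ℤ) (F : MvPolynomial (Fin n) R) (hF : mdeg F ≤ (d : WithBot ℤ))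
    (DF : Fin n → MvPolynomial (Fin n ⊕ Fin n) R)
    (hDF : IsDiffDeriv F DF ∧ IsMonotonous F DF)
    (Df' Df'' : Fin n → Fin n → MvPolynomial (Fin n ⊕ Fin n) R)
    (hDf' : ∀ i, IsDiffDeriv (f i) (Df' i) ∧ IsMonotonous (f i) (Df' i))
    (hDf'' : ∀ i, IsDiffDeriv (f i) (Df'' i) ∧ IsMonotonous (f i) (Df'' i)) :
    applyY L (ddetX f Df' F DF) - applyY L (ddetX f Df'' F DF) ∈
      boundedSpan f ((max (deltaF f) (d - δ - 1) : ℤ) : WithBot ℤ) := by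
  rw [mem_boundedSpan_iff f hf]
  have hdeg : ∀ (D : Fin n → Fin n → MvPolynomial (Fin n ⊕ Fin n) R),
      (∀ i, IsDiffDeriv (f i) (D i) ∧ IsMonotonous (f i) (D i)) →
      ∀ i k, DLe (D i k) (((f i).totalDegree : ℤ) - 1) := by
    intro D hD i k
    have h := (hD i).2 k
    rw [mdeg_eq_totalDegree (hf i)] at h
    exact dle_of_add_one_le h
  refine total_mem f F (fun i => ((f i).totalDegree : ℤ)) d δ hδ L ?_ DF hDF.1
    (fun k => dle_of_add_one_le ((hDF.2 k).trans hF)) Df'' Df'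
    (fun i => (hDf'' i).1) (hdeg _ hDf'') (fun i => (hDf' i).1) (hdeg _ hDf')
  intro p g hg
  refine hL _ ?_
  rw [mem_boundedSpan_iff f hf]
  exact BS_single f _ _ p g hg

end
end
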